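/- arXiv:1307.5138 — 2 statements merged into one kernel-verified Lean document; each statement's English description precedes it below -/
import Mathlib

section
/- Borsuk–Ulam type theorem of Volovikov: Let p ≥ 2 be a prime and let G = (ℤ/p)^k be the elementary abelian group of order p^k. Let X be a topological space with a continuous G-action having no global fixed point (there is no x ∈ X with g·x = x for all g ∈ G), and suppose X is n-connected (X is nonempty, path-connected, and its homotopy groups π_m(X) are trivial for 1 ≤ m ≤ n). Let Y be a topological space homeomorphic to the n-dimensional sphere S^n, equipped with a continuous G-action having no global fixed point. Then there is no continuous G-equivariant map f : X → Y. -/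
noncomputable section

namespace Volovikov

open scoped Pointwise unitInterval Topology

/-! ### A Heisenberg pair forces exactness -/

section Weyl

variable {F M : Type*} [Field F] [AddCommGroup M] [Module F M]

theorem pow_mul_of_commutator_eq_one {R : Type*} [Ring R] {t y : R} (h : t * y = y * t + 1)
    (m : ℕ) : t ^ (m + 1) * y = y * t ^ (m + 1) + (m + 1 : ℕ) * t ^ m := by
  induction m with
  | zero => simpa using h
  | succ m ih =>
    rw [pow_succ', mul_assoc, ih, mul_add, ← mul_assoc t y, h, ← mul_assoc t (Nat.cast _),
      (Nat.cast_commute (m + 1) t).symm.eq, mul_assoc _ t, ← pow_succ']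
    push_cast
    noncomm_ring

theorem mul_pow_of_commutator_eq_one {R : Type*} [Ring R] {t y : R} (h : t * y = y * t + 1)
    (m : ℕ) : t * y ^ (m + 1) = y ^ (m + 1) * t + (m + 1 : ℕ) * y ^ m := by
  induction m with
  | zero => simpa using h
  | succ m ih =>
    rw [pow_succ, ← mul_assoc, ih, add_mul, mul_assoc _ t y, h]
    push_cast
    noncomm_ring

theorem mem_range_of_pow_apply_eq_zero {t y : Module.End F M} (h : t * y = y * t + 1) (m : ℕ)
    (hm : ∀ i, 1 ≤ i → i ≤ m → (i : F) ≠ 0) (v : M) (hv : (t ^ m) v = 0) : ∃ u, t u = v := by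
  induction m generalizing v with
  | zero => exact ⟨0, by simpa using hv.symm⟩
  | succ m ih =>
    have h1 := LinearMap.congr_fun (pow_mul_of_commutator_eq_one h m) v
    have hne := hm (m + 1) (by omega) le_rfl
    have h2 : (t ^ m) (t (y v)) = ((m + 1 : ℕ) : F) • (t ^ m) v := by
      rw [← Module.End.mul_apply, ← pow_succ, ← Module.End.mul_apply, h1, LinearMap.add_apply,
        Module.End.mul_apply, hv, map_zero, zero_add, Module.End.mul_apply,
        Module.End.natCast_apply, Nat.cast_smul_eq_nsmul]
    obtain ⟨u, hu⟩ := ih (fun i h1 h2 => hm i h1 (by omega))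
      (v - ((m + 1 : ℕ) : F)⁻¹ • t (y v)) (by
        rw [map_sub, map_smul, h2, smul_smul, inv_mul_cancel₀ hne, one_smul, sub_self])
    exact ⟨u + ((m + 1 : ℕ) : F)⁻¹ • y v, by rw [map_add, hu, map_smul]; abel⟩

theorem mem_range_pow_of_apply_eq_zero {t y : Module.End F M} (h : t * y = y * t + 1) (m : ℕ)
    (hm : ∀ i, 1 ≤ i → i ≤ m → (i : F) ≠ 0) (v : M) (hv : t v = 0) : ∃ u, (t ^ m) u = v := by
  have key : ∀ m : ℕ, (t ^ m) ((y ^ m) v) = (m.factorial : F) • v := by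
    intro m
    induction m with
    | zero => simp
    | succ m ih =>
      have h1 := LinearMap.congr_fun (mul_pow_of_commutator_eq_one h m) v
      rw [pow_succ, Module.End.mul_apply, ← Module.End.mul_apply t, h1, LinearMap.add_apply,
        Module.End.mul_apply, hv, map_zero, zero_add, Module.End.mul_apply,
        Module.End.natCast_apply, map_nsmul, ih, ← Nat.cast_smul_eq_nsmul F, smul_smul,
        Nat.factorial_succ, Nat.cast_mul]
  have hf : ∀ m : ℕ, (∀ i, 1 ≤ i → i ≤ m → (i : F) ≠ 0) → (m.factorial : F) ≠ 0 := by
    intro m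
    induction m with
    | zero => simp
    | succ m ih =>
      intro hm
      rw [Nat.factorial_succ, Nat.cast_mul]
      exact mul_ne_zero (hm _ (by omega) le_rfl) (ih fun i h1 h2 => hm i h1 (by omega))
  exact ⟨((m.factorial : F)⁻¹) • (y ^ m) v, by
    rw [map_smul, key, smul_smul, inv_mul_cancel₀ (hf m hm), one_smul]⟩

end Weyl

/-! ### Generic shifts in a group algebra -/

theorem sum_pow_char_of_commute {R ι : Type*} [Ring R] (p : ℕ) [Fact p.Prime] [CharP R p]
    (s : Finset ι) (f : ι → R) (hf : ∀ i j, Commute (f i) (f j)) :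
    (∑ i ∈ s, f i) ^ p = ∑ i ∈ s, f i ^ p := by
  classical
  induction s using Finset.induction_on with
  | empty => simp [(Fact.out : p.Prime).ne_zero]
  | insert a s ha ih =>
    rw [Finset.sum_insert ha, Finset.sum_insert ha,
      add_pow_char_of_commute p (Commute.sum_right _ _ _ fun i _ => hf a i), ih]

theorem sum_smul_sub_one_pow {F R ι : Type*} [Field F] [Ring R] [Algebra F R] (p : ℕ)
    [Fact p.Prime] [CharP R p] (s : Finset ι) (a : ι → F) (T : ι → R)
    (hT : ∀ i j, Commute (T i) (T j)) (hTp : ∀ i, T i ^ p = 1) :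
    (∑ i ∈ s, a i • (T i - 1)) ^ p = 0 := by
  rw [sum_pow_char_of_commute p]
  · refine Finset.sum_eq_zero fun i _ => ?_
    rw [smul_pow, sub_pow_char_of_commute _ (Commute.one_right _), hTp]
    simp
  · intro i j
    refine Commute.smul_left (Commute.smul_right ?_ _) _
    exact ((hT _ _).sub_right (Commute.one_right _)).sub_left
      ((Commute.one_left _).sub_right (Commute.one_left _))

theorem exists_commutator_eq_one_of_commute {F R ι : Type*} [Field F] [Ring R] [Algebra F R]
    (p : ℕ) [Fact p.Prime] [CharP R p] (s : Finset ι) (a : ι → F) (T D : ι → R) (X C : R)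
    (hT : ∀ i j, Commute (T i) (T j)) (hTp : ∀ i, T i ^ p = 1)
    (hDT : ∀ i j, Commute (D i) (T j)) (hDD : ∀ i j, Commute (D i) (D j))
    (hCT : ∀ i, Commute C (T i)) (hX : ∀ i, X * T i = T i * X + T i * D i)
    (hC : (∑ i ∈ s, a i ^ p • D i ^ p) * C = 1) :
    ∃ y : R, (∑ i ∈ s, a i • (T i - 1)) * y = y * (∑ i ∈ s, a i • (T i - 1)) + 1 := by
  have hp := (Fact.out : p.Prime)
  set t := ∑ i ∈ s, a i • (T i - 1) with ht
  set U := ∑ i ∈ s, a i • (T i * D i) with hU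
  have htX : t * X = X * t - U := by
    rw [ht, hU, Finset.sum_mul, Finset.mul_sum, ← Finset.sum_sub_distrib]
    refine Finset.sum_congr rfl fun i _ => ?_
    rw [smul_mul_assoc, mul_smul_comm, ← smul_sub, sub_mul, mul_sub, hX]
    congr 1
    noncomm_ring
  have hUp : U ^ p = ∑ i ∈ s, a i ^ p • D i ^ p := by
    rw [hU, sum_pow_char_of_commute p]
    · refine Finset.sum_congr rfl fun i _ => ?_
      rw [smul_pow, (hDT i i).symm.mul_pow, hTp, one_mul]
    · intro i j
      refine Commute.smul_left (Commute.smul_right ?_ _) _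
      exact ((hT _ _).mul_right (hDT j i).symm).mul_left ((hDT i j).mul_right (hDD _ _))
  have htU : Commute t U := by
    refine Commute.sum_left _ _ _ fun i _ => Commute.sum_right _ _ _ fun j _ => ?_
    refine Commute.smul_left (Commute.smul_right ?_ _) _
    exact ((hT _ _).mul_right (hDT j i).symm).sub_left (Commute.one_left _)
  have htC : Commute t C := by
    refine Commute.sum_left _ _ _ fun i _ => ?_
    exact ((hCT i).symm.sub_left (Commute.one_left _)).smul_left _
  have hUinv : U * (U ^ (p - 1) * C) = 1 := by
    rw [← mul_assoc, ← pow_succ', Nat.sub_add_cancel hp.one_le, hUp, hC]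
  set V := U ^ (p - 1) * C
  have htV : Commute t V := (htU.pow_right _).mul_right htC
  refine ⟨-(X * V), ?_⟩
  rw [mul_neg, ← mul_assoc, htX, sub_mul, hUinv, neg_mul, mul_assoc _ V, ← htV.eq, mul_assoc]
  abel

/-- The permutation representation of `G` on the vector space with basis a `G`-set. -/
def translate (F : Type*) [Field F] {G : Type*} [Monoid G] (S : Type*) [MulAction G S] :
    G →* Module.End F (S →₀ F) where
  toFun g := Finsupp.lmapDomain F F (g • ·)
  map_one' := by ext; simp
  map_mul' g h := by ext; simp [mul_smul]

theorem translate_single {F : Type*} [Field F] {G : Type*} [Monoid G] {S : Type*} [MulAction G S]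
    (g : G) (s : S) (r : F) :
    translate F S g (Finsupp.single s r) = Finsupp.single (g • s) r := by
  simp [translate]

/-- The element `∑ aᵢ (γᵢ - 1)` of the group algebra acting on a permutation representation. -/
def shift {F ι G : Type*} [Field F] [Fintype ι] [Monoid G] (a : ι → F) (γ : ι → G)
    (S : Type*) [MulAction G S] : Module.End F (S →₀ F) :=
  ∑ i, a i • (translate F S (γ i) - 1)

/-- The diagonal operator with prescribed eigenvalues. -/
def diag {F S : Type*} [Field F] (f : S → F) : Module.End F (S →₀ F) :=
  Finsupp.linearCombination F fun s => Finsupp.single s (f s)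

theorem diag_single {F S : Type*} [Field F] (f : S → F) (s : S) (r : F) :
    diag f (Finsupp.single s r) = Finsupp.single s (r * f s) := by
  simp [diag]

theorem diag_mul_diag {F S : Type*} [Field F] (f g : S → F) :
    diag f * diag g = diag (f * g) := by
  ext s : 2
  simp [diag_single, mul_comm]

theorem diag_pow {F S : Type*} [Field F] (f : S → F) (n : ℕ) :
    diag f ^ n = diag (f ^ n) := by
  induction n with
  | zero => ext s : 2; simp [diag_single]
  | succ n ih => rw [pow_succ, ih, diag_mul_diag, pow_succ]

theorem charP_end (F S : Type*) [Field F] (p : ℕ) [CharP F p] [Nonempty S] :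
    CharP (Module.End F (S →₀ F)) p :=
  charP_of_injective_algebraMap (algebraMap F (Module.End F (S →₀ F))).injective p

section Shift

variable {F ι G S T : Type*} [Field F] [Fintype ι]

theorem shift_comm_of_equivariant [Monoid G] [MulAction G S] [MulAction G T] (a : ι → F)
    (γ : ι → G)
    (Φ : (S →₀ F) →ₗ[F] (T →₀ F))
    (hΦ : ∀ (g : G) (s : S), Φ (Finsupp.single (g • s) 1) =
      translate F T g (Φ (Finsupp.single s 1))) (x : S →₀ F) :
    Φ (shift a γ S x) = shift a γ T (Φ x) := by
  have h : ∀ g : G, Φ ∘ₗ translate F S g = translate F T g ∘ₗ Φ := by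
    intro g
    ext s : 2
    simp [translate_single, hΦ]
  have h' : ∀ (g : G) x, Φ (translate F S g x) = translate F T g (Φ x) :=
    fun g => LinearMap.congr_fun (h g)
  simp [shift, LinearMap.sum_apply, map_sum, h']

theorem shift_pow_comm_of_equivariant [Monoid G] [MulAction G S] [MulAction G T] (a : ι → F)
    (γ : ι → G)
    (Φ : (S →₀ F) →ₗ[F] (T →₀ F))
    (hΦ : ∀ (g : G) (s : S), Φ (Finsupp.single (g • s) 1) =
      translate F T g (Φ (Finsupp.single s 1))) (e : ℕ) (x : S →₀ F) :
    Φ ((shift a γ S ^ e) x) = (shift a γ T ^ e) (Φ x) := by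
  induction e generalizing x with
  | zero => simp
  | succ e ih =>
    rw [pow_succ', pow_succ', Module.End.mul_apply, Module.End.mul_apply,
      shift_comm_of_equivariant a γ Φ hΦ, ih]

theorem shift_pow_eq_zero [CommGroup G] [MulAction G S] (p : ℕ) [Fact p.Prime] [CharP F p]
    (a : ι → F) (γ : ι → G) (hγ : ∀ i, γ i ^ p = 1) : shift a γ S ^ p = 0 := by
  cases isEmpty_or_nonempty S
  · exact Subsingleton.elim _ _
  have := charP_end F S p
  exact sum_smul_sub_one_pow p Finset.univ a (fun i => translate F S (γ i))
    (fun i j => (Commute.all (γ i) (γ j)).map _)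
    (fun i => by rw [← map_pow, hγ, map_one])

theorem commute_diag_translate [Monoid G] [MulAction G S] (f : S → F) (g : G)
    (hf : ∀ s, f (g • s) = f s) : Commute (diag f) (translate F S g) := by
  have : diag f * translate F S g = translate F S g * diag f := by
    ext s : 2
    simp [diag_single, translate_single, hf]
  exact this

/-- If every orbit of `S` maps equivariantly onto a cyclic quotient on which the shift acts
nontrivially, then the shift has a Heisenberg partner. -/
theorem exists_commutator_eq_one [CommGroup G] [MulAction G S] (p : ℕ) [Fact p.Prime] [CharP F p]
    (a : ι → F) (γ : ι → G) (hγ : ∀ i, γ i ^ p = 1) (x : S → F) (χ : S → ι → F)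
    (hx : ∀ s i, x (γ i • s) = x s + χ s i) (hχ : ∀ s i, χ (γ i • s) = χ s)
    (hne : ∀ s, ∑ i, a i * χ s i ≠ 0) :
    ∃ y : Module.End F (S →₀ F), shift a γ S * y = y * shift a γ S + 1 := by
  cases isEmpty_or_nonempty S
  · exact ⟨0, Subsingleton.elim _ _⟩
  have := charP_end F S p
  refine exists_commutator_eq_one_of_commute p Finset.univ a (fun i => translate F S (γ i))
    (fun i => diag fun s => χ s i) (diag x) (diag fun s => ((∑ i, a i * χ s i) ^ p)⁻¹)
    (fun i j => (Commute.all (γ i) (γ j)).map _) (fun i => by rw [← map_pow, hγ, map_one])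
    (fun i j => commute_diag_translate _ _ fun s => by rw [hχ])
    (fun i j => ?_) (fun i => commute_diag_translate _ _ fun s => by rw [hχ]) (fun i => ?_) ?_
  · rw [Commute, SemiconjBy, diag_mul_diag, diag_mul_diag, mul_comm]
  · ext s : 2
    simp [diag_single, translate_single, hx]
  · ext s : 2
    simp only [diag_pow, LinearMap.comp_apply, Finsupp.lsingle_apply, Module.End.mul_apply,
      diag_single, LinearMap.sum_apply, LinearMap.smul_apply, Module.End.one_apply, one_mul,
      Finsupp.smul_single, ← Finsupp.single_finsetSum, Pi.pow_apply]
    congr 1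
    have hs := pow_ne_zero p (hne s)
    rw [sum_pow_char] at hs ⊢
    simp only [mul_pow, smul_eq_mul] at hs ⊢
    rw [← inv_mul_cancel₀ hs, Finset.mul_sum]
    exact Finset.sum_congr rfl fun i _ => by ring

end Shift

/-! ### Exactness for fixed-point free permutation representations -/

section FixedPointFree

variable {p k : ℕ} [Fact p.Prime]

/-- The `i`-th standard generator of `(ℤ/p)^k`. -/
def gen (p k : ℕ) (i : Fin k) : Multiplicative (Fin k → ZMod p) :=
  Multiplicative.ofAdd (Pi.single i 1)

theorem gen_pow (i : Fin k) : gen p k i ^ p = 1 := by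
  rw [gen, ← ofAdd_nsmul, ← ofAdd_zero]
  congr 1
  ext j
  simp

theorem exists_linear_functional_of_fixedPointFree {S : Type*}
    [MulAction (Multiplicative (Fin k → ZMod p)) S]
    (hS : ¬ ∃ s : S, ∀ g : Multiplicative (Fin k → ZMod p), g • s = s) (s : S) :
    ∃ f : (Fin k → ZMod p) →ₗ[ZMod p] ZMod p, f ≠ 0 ∧
      ∀ v, Multiplicative.ofAdd v • s = s → f v = 0 := by
  let A : AddSubgroup (Fin k → ZMod p) :=
    { carrier := {v | Multiplicative.ofAdd v • s = s}
      zero_mem' := by simp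
      add_mem' := by
        intro v w hv hw
        simp only [Set.mem_ofPred_eq] at hv hw ⊢
        rw [ofAdd_add, mul_smul, hw, hv]
      neg_mem' := by
        intro v hv
        simp only [Set.mem_ofPred_eq] at hv ⊢
        rw [ofAdd_neg, inv_smul_eq_iff, hv] }
  have hlt : AddSubgroup.toZModSubmodule p A < ⊤ := by
    refine lt_top_iff_ne_top.2 fun h => hS ⟨s, fun g => ?_⟩
    have : Multiplicative.toAdd g ∈ AddSubgroup.toZModSubmodule p A := h ▸ Submodule.mem_top
    exact this
  obtain ⟨f, hf, hle⟩ := Submodule.exists_le_ker_of_lt_top _ hlt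
  exact ⟨f, hf, fun v hv => hle (show v ∈ A from hv)⟩

theorem exists_cocycle_of_fixedPointFree {F S : Type*} [Field F] [Algebra (ZMod p) F]
    [MulAction (Multiplicative (Fin k → ZMod p)) S] (a : Fin k → F)
    (ha : LinearIndependent (ZMod p) a)
    (hS : ¬ ∃ s : S, ∀ g : Multiplicative (Fin k → ZMod p), g • s = s) :
    ∃ (x : S → F) (χ : S → Fin k → F), (∀ s i, x (gen p k i • s) = x s + χ s i) ∧
      (∀ s i, χ (gen p k i • s) = χ s) ∧ ∀ s, ∑ i, a i * χ s i ≠ 0 := by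
  choose f hf0 hf using fun s : S => exists_linear_functional_of_fixedPointFree hS s
  let G := Multiplicative (Fin k → ZMod p)
  let r : S → S := fun s => (Quotient.mk (MulAction.orbitRel G S) s).out
  have hr : ∀ (g : G) (s : S), r (g • s) = r s := by
    intro g s
    have : Quotient.mk (MulAction.orbitRel G S) (g • s) = Quotient.mk _ s :=
      Quotient.sound ⟨g, rfl⟩
    simp only [r, this]
  have hex : ∀ s : S, ∃ g : G, g • r s = s := by
    intro s
    have h := Quotient.mk_out (s := MulAction.orbitRel G S) s
    exact (MulAction.orbitRel G S).symm h
  choose g hg using hex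
  refine ⟨fun s => algebraMap (ZMod p) F (f (r s) (Multiplicative.toAdd (g s))),
    fun s i => algebraMap (ZMod p) F (f (r s) (Pi.single i 1)), ?_, ?_, ?_⟩
  · intro s i
    simp only [hr]
    rw [← map_add, ← map_add]
    congr 1
    rw [← sub_eq_zero, ← map_sub]
    apply hf
    rw [ofAdd_sub, ofAdd_add, ofAdd_toAdd, ofAdd_toAdd, div_eq_inv_mul, mul_smul]
    have h1 : g (gen p k i • s) • r s = gen p k i • s := by
      conv_lhs => rw [← hr (gen p k i) s]
      exact hg _
    rw [h1, inv_smul_eq_iff, mul_comm, mul_smul, hg, gen]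
  · intro s i
    simp only [hr]
  · intro s h0
    apply hf0 (r s)
    rw [Fintype.linearIndependent_iff] at ha
    have := ha (fun i => f (r s) (Pi.single i 1)) (by
      rw [← h0]
      exact Finset.sum_congr rfl fun i _ => by rw [Algebra.smul_def, mul_comm])
    refine LinearMap.pi_ext' fun i => LinearMap.ext_ring ?_
    simpa using this i

/-- The exponents of the periodic resolution: `1` in even degrees, `p - 1` in odd degrees. -/
def expo (p i : ℕ) : ℕ := if Even i then 1 else p - 1

theorem expo_add_expo_succ (i : ℕ) : expo p i + expo p (i + 1) = p := by
  have := (Fact.out : p.Prime).two_le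
  by_cases h : Even i <;> simp [expo, Nat.even_add_one, h] <;> omega

theorem expo_pos (i : ℕ) : 0 < expo p i := by
  have := (Fact.out : p.Prime).two_le
  by_cases h : Even i <;> simp [expo, h]; omega

theorem exists_shift_pow_eq {F S : Type*} [Field F] [Algebra (ZMod p) F]
    [MulAction (Multiplicative (Fin k → ZMod p)) S] (a : Fin k → F)
    (ha : LinearIndependent (ZMod p) a)
    (hS : ¬ ∃ s : S, ∀ g : Multiplicative (Fin k → ZMod p), g • s = s) (i : ℕ) (v : S →₀ F)
    (hv : (shift a (gen p k) S ^ expo p i) v = 0) :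
    ∃ u, (shift a (gen p k) S ^ expo p (i + 1)) u = v := by
  have : CharP F p := charP_of_injective_algebraMap (algebraMap (ZMod p) F).injective p
  obtain ⟨x, χ, hx, hχ, hne⟩ := exists_cocycle_of_fixedPointFree a ha hS
  obtain ⟨y, hy⟩ := exists_commutator_eq_one p a (gen p k) gen_pow x χ hx hχ hne
  have hm : ∀ i, 1 ≤ i → i ≤ p - 1 → (i : F) ≠ 0 := by
    intro i h1 h2 h0
    rw [CharP.cast_eq_zero_iff F p] at h0
    have := Nat.le_of_dvd h1 h0
    omega
  by_cases h : Even i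
  · simp only [expo, h, if_true, Nat.even_add_one, not_true, if_false, pow_one] at hv ⊢
    exact mem_range_pow_of_apply_eq_zero hy _ hm v hv
  · simp only [expo, h, if_true, Nat.even_add_one, not_false_eq_true, if_false, pow_one] at hv ⊢
    exact mem_range_of_pow_apply_eq_zero hy _ hm v hv

theorem exists_shift_pow_eq_of_support {F S : Type*} [Field F] [Algebra (ZMod p) F]
    [MulAction (Multiplicative (Fin k → ZMod p)) S] (a : Fin k → F)
    (ha : LinearIndependent (ZMod p) a) (Q : Set S)
    (hQ : ∀ (g : Multiplicative (Fin k → ZMod p)), ∀ s ∈ Q, g • s ∈ Q)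
    (hS : ¬ ∃ s ∈ Q, ∀ g : Multiplicative (Fin k → ZMod p), g • s = s) (i : ℕ) (v : S →₀ F)
    (hvQ : ∀ s ∈ v.support, s ∈ Q) (hv : (shift a (gen p k) S ^ expo p i) v = 0) :
    ∃ u : S →₀ F, (∀ s ∈ u.support, s ∈ Q) ∧ (shift a (gen p k) S ^ expo p (i + 1)) u = v := by
  let Q' : SubMulAction (Multiplicative (Fin k → ZMod p)) S := ⟨Q, fun g _ h => hQ g _ h⟩
  let Φ : (Q' →₀ F) →ₗ[F] (S →₀ F) := Finsupp.lmapDomain F F Subtype.val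
  have hΦ : Function.Injective Φ := Finsupp.mapDomain_injective Subtype.val_injective
  have hcomm : ∀ e x, Φ ((shift a (gen p k) Q' ^ e) x) = (shift a (gen p k) S ^ e) (Φ x) :=
    shift_pow_comm_of_equivariant a (gen p k) Φ fun g s => by
      simp [Φ, translate_single]
  obtain ⟨v', rfl⟩ : ∃ v', Φ v' = v := by
    exact ⟨_, Finsupp.mapDomain_comapDomain _ Subtype.val_injective v
      fun s hs => ⟨⟨s, hvQ s hs⟩, rfl⟩⟩
  obtain ⟨u, hu⟩ := exists_shift_pow_eq a ha (S := Q') (by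
    rintro ⟨s, hs⟩
    exact hS ⟨s, s.2, fun g => congrArg Subtype.val (hs g)⟩) i v' (hΦ (by rw [hcomm, hv, map_zero]))
  refine ⟨Φ u, ?_, by rw [← hcomm, hu]⟩
  intro s hs
  classical
  obtain ⟨q, -, rfl⟩ := Finset.mem_image.1 (Finsupp.mapDomain_support hs)
  exact q.2

end FixedPointFree

/-! ### The chain complex of finite sequences -/

section ListComplex

variable {F : Type*} [Field F] {α β : Type*}

theorem map_mem_supported {S T : Type*} (Φ : (S →₀ F) →ₗ[F] (T →₀ F)) {P : Set S} {Q : Set T}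
    (h : ∀ s ∈ P, Φ (Finsupp.single s 1) ∈ Finsupp.supported F F Q) {x : S →₀ F}
    (hx : x ∈ Finsupp.supported F F P) : Φ x ∈ Finsupp.supported F F Q := by
  rw [Finsupp.supported_eq_span_single] at hx
  refine Submodule.span_induction ?_ (by simp) (fun x y _ _ hx hy => ?_) (fun r x _ hx => ?_) hx
  · rintro _ ⟨s, hs, rfl⟩
    exact h s hs
  · rw [map_add]
    exact add_mem hx hy
  · rw [map_smul]
    exact Submodule.smul_mem _ _ hx

theorem eq_zero_of_forall_mem {S : Type*} {N : Type*} [AddCommGroup N] [Module F N]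
    (Φ : (S →₀ F) →ₗ[F] N) {P : Set S} (h : ∀ s ∈ P, Φ (Finsupp.single s 1) = 0) {x : S →₀ F}
    (hx : x ∈ Finsupp.supported F F P) : Φ x = 0 := by
  rw [Finsupp.supported_eq_span_single] at hx
  refine Submodule.span_induction ?_ (by simp) (fun x y _ _ hx hy => ?_) (fun r x _ hx => ?_) hx
  · rintro _ ⟨s, hs, rfl⟩
    exact h s hs
  · rw [map_add, hx, hy, add_zero]
  · rw [map_smul, hx, smul_zero]

/-- Prepend a letter to every sequence of a chain. -/
def consL (F : Type*) [Field F] {α : Type*} (a : α) : (List α →₀ F) →ₗ[F] (List α →₀ F) :=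
  Finsupp.lmapDomain F F (List.cons a)

@[simp]
theorem consL_single (a : α) (l : List α) (r : F) :
    consL F a (Finsupp.single l r) = Finsupp.single (a :: l) r := by
  simp [consL]

/-- The alternating sum of the sequences obtained by deleting one letter. -/
def bdList (F : Type*) [Field F] {α : Type*} : List α → (List α →₀ F)
  | [] => 0
  | a :: l => Finsupp.single l 1 - consL F a (bdList F l)

/-- The augmented boundary operator of the complex of finite sequences. -/
def bd (F : Type*) [Field F] (α : Type*) : (List α →₀ F) →ₗ[F] (List α →₀ F) :=
  Finsupp.linearCombination F (bdList F)

@[simp]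
theorem bd_single (l : List α) (r : F) : bd F α (Finsupp.single l r) = r • bdList F l := by
  simp [bd]

theorem bd_consL (a : α) (x : List α →₀ F) :
    bd F α (consL F a x) = x - consL F a (bd F α x) := by
  have : bd F α ∘ₗ consL F a = LinearMap.id - consL F a ∘ₗ bd F α := by
    ext l : 2
    simp [bdList]
  exact LinearMap.congr_fun this x

theorem bd_bdList (l : List α) : bd F α (bdList F l) = 0 := by
  induction l with
  | nil => simp [bdList]
  | cons a l ih => rw [bdList, map_sub, bd_single, one_smul, bd_consL, ih, map_zero]; abel

/-- The map of chains induced by a map of letters. -/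
def mapL (F : Type*) [Field F] {α β : Type*} (f : α → β) : (List α →₀ F) →ₗ[F] (List β →₀ F) :=
  Finsupp.lmapDomain F F (List.map f)

@[simp]
theorem mapL_single (f : α → β) (l : List α) (r : F) :
    mapL F f (Finsupp.single l r) = Finsupp.single (l.map f) r := by
  simp [mapL]

theorem mapL_consL (f : α → β) (a : α) (x : List α →₀ F) :
    mapL F f (consL F a x) = consL F (f a) (mapL F f x) := by
  have : mapL F f ∘ₗ consL F a = consL F (f a) ∘ₗ mapL F f := by
    ext l : 2
    simp
  exact LinearMap.congr_fun this x

theorem bdList_map (f : α → β) (l : List α) : bdList F (l.map f) = mapL F f (bdList F l) := by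
  induction l with
  | nil => simp [bdList]
  | cons a l ih => rw [List.map_cons, bdList, bdList, ih, map_sub, mapL_single, mapL_consL]

theorem bd_mapL (f : α → β) (x : List α →₀ F) :
    bd F β (mapL F f x) = mapL F f (bd F α x) := by
  have : bd F β ∘ₗ mapL F f = mapL F f ∘ₗ bd F α := by
    ext l : 2
    simp [bdList_map]
  exact LinearMap.congr_fun this x

open Classical in
/-- The projection killing the sequences with two equal consecutive letters. -/
def nondeg (F : Type*) [Field F] (α : Type*) : (List α →₀ F) →ₗ[F] (List α →₀ F) :=
  Finsupp.linearCombination F fun l =>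
    if l.IsChain (· ≠ ·) then Finsupp.single l 1 else 0

theorem nondeg_single_of_isChain {l : List α} (h : l.IsChain (· ≠ ·)) (r : F) :
    nondeg F α (Finsupp.single l r) = Finsupp.single l r := by
  simp [nondeg, h]

theorem nondeg_single_of_not_isChain {l : List α} (h : ¬ l.IsChain (· ≠ ·)) (r : F) :
    nondeg F α (Finsupp.single l r) = 0 := by
  simp [nondeg, h]

theorem comp_nondeg_of_forall {N : Type*} [AddCommGroup N] [Module F N]
    (Φ : (List α →₀ F) →ₗ[F] N)
    (h : ∀ l : List α, ¬ l.IsChain (· ≠ ·) → Φ (Finsupp.single l 1) = 0) (x : List α →₀ F) :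
    Φ (nondeg F α x) = Φ x := by
  have : Φ ∘ₗ nondeg F α = Φ := by
    ext l : 2
    by_cases hl : l.IsChain (· ≠ ·)
    · simp [nondeg_single_of_isChain hl]
    · simp [nondeg_single_of_not_isChain hl, h l hl]
  exact LinearMap.congr_fun this x

theorem nondeg_consL_nondeg (a : α) (x : List α →₀ F) :
    nondeg F α (consL F a (nondeg F α x)) = nondeg F α (consL F a x) :=
  comp_nondeg_of_forall (nondeg F α ∘ₗ consL F a) (fun l hl => by
    rw [LinearMap.comp_apply, consL_single]
    exact nondeg_single_of_not_isChain (fun h => hl h.tail) 1) x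

theorem nondeg_mapL_nondeg (f : α → β) (x : List α →₀ F) :
    nondeg F β (mapL F f (nondeg F α x)) = nondeg F β (mapL F f x) :=
  comp_nondeg_of_forall (nondeg F β ∘ₗ mapL F f) (fun l hl => by
    rw [LinearMap.comp_apply, mapL_single]
    refine nondeg_single_of_not_isChain (fun h => hl ?_) 1
    rw [List.isChain_map] at h
    exact h.imp fun a b hab he => hab (he ▸ rfl)) x

theorem nondeg_consL_consL (a : α) (x : List α →₀ F) :
    nondeg F α (consL F a (consL F a x)) = 0 := by
  have : nondeg F α ∘ₗ consL F a ∘ₗ consL F a = 0 := by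
    ext l : 2
    simp only [LinearMap.comp_apply, Finsupp.lsingle_apply, consL_single, LinearMap.zero_apply]
    exact nondeg_single_of_not_isChain (by simp) 1
  exact LinearMap.congr_fun this x

theorem nondeg_bdList_of_not_isChain (l : List α) (hl : ¬ l.IsChain (· ≠ ·)) :
    nondeg F α (bdList F l) = 0 := by
  induction l with
  | nil => simp at hl
  | cons a l ih =>
    rw [bdList, map_sub]
    by_cases h : l.IsChain (· ≠ ·)
    · rcases l with _ | ⟨b, l⟩
      · simp at hl
      · obtain rfl : a = b := by
          by_contra hab
          exact hl (List.isChain_cons_cons.2 ⟨hab, h⟩)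
        rw [bdList, map_sub, map_sub, nondeg_consL_consL, consL_single, sub_zero, sub_self]
    · rw [nondeg_single_of_not_isChain h, ← nondeg_consL_nondeg, ih h]
      simp

theorem nondeg_bd_nondeg (x : List α →₀ F) :
    nondeg F α (bd F α (nondeg F α x)) = nondeg F α (bd F α x) :=
  comp_nondeg_of_forall (nondeg F α ∘ₗ bd F α) (fun l hl => by
    rw [LinearMap.comp_apply, bd_single, one_smul, nondeg_bdList_of_not_isChain l hl]) x

/-- The prism operator between the identity and the map induced by `ψ`, on a sequence. -/
def prismList (F : Type*) [Field F] {α : Type*} (ψ : α → α) : List α → (List α →₀ F)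
  | [] => 0
  | a :: l => consL F (ψ a) (Finsupp.single (a :: l) 1) - consL F (ψ a) (prismList F ψ l)

/-- The prism operator between the identity and the map induced by `ψ`. -/
def prism (F : Type*) [Field F] {α : Type*} (ψ : α → α) : (List α →₀ F) →ₗ[F] (List α →₀ F) :=
  Finsupp.linearCombination F (prismList F ψ)

@[simp]
theorem prism_single (ψ : α → α) (l : List α) (r : F) :
    prism F ψ (Finsupp.single l r) = r • prismList F ψ l := by
  simp [prism]

theorem prism_consL (ψ : α → α) (a : α) (x : List α →₀ F) :
    prism F ψ (consL F a x) = consL F (ψ a) (consL F a x) - consL F (ψ a) (prism F ψ x) := by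
  have : prism F ψ ∘ₗ consL F a =
      consL F (ψ a) ∘ₗ consL F a - consL F (ψ a) ∘ₗ prism F ψ := by
    ext l : 2
    simp [prismList]
  exact LinearMap.congr_fun this x

theorem bd_prism (ψ : α → α) (x : List α →₀ F) :
    bd F α (prism F ψ x) = x - mapL F ψ x - prism F ψ (bd F α x) := by
  have : bd F α ∘ₗ prism F ψ = LinearMap.id - mapL F ψ - prism F ψ ∘ₗ bd F α := by
    ext l : 2
    simp only [LinearMap.comp_apply, Finsupp.lsingle_apply, prism_single, bd_single, one_smul,
      LinearMap.sub_apply, LinearMap.id_apply, mapL_single]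
    induction l with
    | nil => simp [prismList, bdList]
    | cons a l ih =>
      rw [prismList, bdList, map_sub, map_sub, bd_consL, bd_consL, ih, bd_single, one_smul,
        prism_consL, prism_single, one_smul, bdList]
      simp only [map_sub, consL_single, List.map_cons]
      abel
  exact LinearMap.congr_fun this x

theorem nondeg_prism_nondeg (ψ : α → α) (x : List α →₀ F) :
    nondeg F α (prism F ψ (nondeg F α x)) = nondeg F α (prism F ψ x) := by
  refine comp_nondeg_of_forall (nondeg F α ∘ₗ prism F ψ) (fun l hl => ?_) x
  rw [LinearMap.comp_apply, prism_single, one_smul]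
  induction l with
  | nil => simp at hl
  | cons a l ih =>
    rw [prismList, map_sub, consL_single,
      nondeg_single_of_not_isChain fun h => hl h.tail]
    by_cases h : l.IsChain (· ≠ ·)
    · rcases l with _ | ⟨b, l⟩
      · simp at hl
      · obtain rfl : a = b := by
          by_contra hab
          exact hl (List.isChain_cons_cons.2 ⟨hab, h⟩)
        rw [prismList, ← map_sub, nondeg_consL_consL, sub_zero]
    · rw [← nondeg_consL_nondeg, ih h]
      simp

/-- The weakly decreasing sequences of length `m` with letters in `Q`. -/
def decLists [LE α] (Q : Set α) (m : ℕ) : Set (List α) :=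
  {l | l.length = m ∧ l.Pairwise (· ≥ ·) ∧ ∀ a ∈ l, a ∈ Q}

theorem prism_mem_supported [Preorder α] (ψ : α → α) (hmono : Monotone ψ) (hle : ∀ a, a ≤ ψ a)
    {Q Q' : Set α} (hQ : Q ⊆ Q') (hψ : ∀ a ∈ Q, ψ a ∈ Q') {m : ℕ} {x : List α →₀ F}
    (hx : x ∈ Finsupp.supported F F (decLists Q m)) :
    prism F ψ x ∈ Finsupp.supported F F (decLists Q' (m + 1)) := by
  have key : ∀ (l : List α) (b : α), (∀ a ∈ l, a ≤ b) → l ∈ decLists Q l.length →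
      prismList F ψ l ∈
        Finsupp.supported F F (decLists Q' (l.length + 1) ∩ {l' | ∀ a ∈ l', a ≤ ψ b}) := by
    intro l
    induction l with
    | nil => intro b _ _; exact zero_mem _
    | cons a l ih =>
      rintro b hb ⟨-, h2, h3⟩
      rw [List.pairwise_cons] at h2
      rw [List.forall_mem_cons] at h3 hb
      rw [prismList]
      have hab := hmono hb.1
      refine sub_mem ?_ ?_
      · rw [consL_single]
        refine Finsupp.single_mem_supported F _ ⟨⟨by simp, ?_, ?_⟩, ?_⟩
        · rw [List.pairwise_cons, List.pairwise_cons, List.forall_mem_cons]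
          exact ⟨⟨hle a, fun c hc => (h2.1 c hc).trans (hle a)⟩, h2⟩
        · rw [List.forall_mem_cons, List.forall_mem_cons]
          exact ⟨hψ a h3.1, hQ h3.1, fun c hc => hQ (h3.2 c hc)⟩
        · change ∀ c ∈ _, _
          rw [List.forall_mem_cons, List.forall_mem_cons]
          exact ⟨hab, (hle a).trans hab, fun c hc => (hb.2 c hc).trans (hle b)⟩
      · refine map_mem_supported (consL F (ψ a)) ?_ (ih a h2.1 ⟨rfl, h2.2, h3.2⟩)
        rintro l' ⟨⟨hl1, hl2, hl3⟩, hl4⟩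
        rw [consL_single]
        refine Finsupp.single_mem_supported F _ ⟨⟨by simp [hl1], ?_, ?_⟩, ?_⟩
        · exact List.pairwise_cons.2 ⟨hl4, hl2⟩
        · exact List.forall_mem_cons.2 ⟨hψ a h3.1, hl3⟩
        · exact List.forall_mem_cons.2 ⟨hab, fun c hc => (hl4 c hc).trans hab⟩
  refine map_mem_supported (prism F ψ) ?_ hx
  rintro l ⟨rfl, h2, h3⟩
  rw [prism_single, one_smul]
  rcases l with _ | ⟨a, l⟩
  · exact zero_mem _
  · refine Finsupp.supported_mono Set.inter_subset_left
      (key (a :: l) a ?_ ⟨rfl, h2, h3⟩)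
    rw [List.pairwise_cons] at h2
    exact List.forall_mem_cons.2 ⟨le_rfl, h2.1⟩

theorem length_le_of_rank [PartialOrder α] (ρ : α → ℕ) (N : ℕ) (l : List α) (hN : ∀ a ∈ l, ρ a ≤ N)
    (hρ : ∀ a ∈ l, ∀ b ∈ l, b < a → ρ a < ρ b) (h1 : l.Pairwise (· ≥ ·))
    (h2 : l.IsChain (· ≠ ·)) : l.length ≤ N + 1 := by
  have key : ∀ (l : List α), (∀ a ∈ l, ρ a ≤ N) →
    (∀ a ∈ l, ∀ b ∈ l, b < a → ρ a < ρ b) → l.Pairwise (· ≥ ·) →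
    l.IsChain (· ≠ ·) → ∀ a ∈ l.head?, ρ a + l.length ≤ N + 1 := by
    intro l
    induction l with
    | nil => simp
    | cons a l ih =>
      intro hN hρ h1 h2 a' ha'
      obtain rfl : a = a' := by simpa using ha'
      rcases l with _ | ⟨b, l⟩
      · simpa using hN
      · have := ih (fun c hc => hN c (List.mem_cons_of_mem _ hc))
          (fun c hc d hd => hρ c (List.mem_cons_of_mem _ hc) d (List.mem_cons_of_mem _ hd))
          h1.of_cons h2.tail b (by simp)
        have hlt : ρ a < ρ b := hρ a (by simp) b (by simp)
          (lt_of_le_of_ne ((List.pairwise_cons.1 h1).1 b (by simp))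
            (List.isChain_cons_cons.1 h2).1.symm)
        simp only [List.length_cons] at this ⊢
        omega
  rcases l with _ | ⟨a, l⟩
  · simp
  · have := key (a :: l) hN hρ h1 h2 a (by simp)
    omega

theorem nondeg_mapL_eq_zero [PartialOrder α] (ψ : α → α) (hmono : Monotone ψ) {Q : Set α}
    (ρ : α → ℕ) (N : ℕ) (hN : ∀ a ∈ Q, ρ (ψ a) ≤ N)
    (hρ : ∀ a ∈ Q, ∀ b ∈ Q, ψ b < ψ a → ρ (ψ a) < ρ (ψ b)) {m : ℕ} (hm : N + 1 < m)
    {x : List α →₀ F} (hx : x ∈ Finsupp.supported F F (decLists Q m)) :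
    nondeg F α (mapL F ψ x) = 0 := by
  refine eq_zero_of_forall_mem (nondeg F α ∘ₗ mapL F ψ) ?_ hx
  rintro l ⟨rfl, h2, h3⟩
  rw [LinearMap.comp_apply, mapL_single]
  refine nondeg_single_of_not_isChain (fun h => ?_) 1
  have := length_le_of_rank ρ N (l.map ψ) (by simpa using fun a ha => hN a (h3 a ha))
    (by simpa using fun a ha b hb => hρ a (h3 a ha) b (h3 b hb))
    (List.pairwise_map.2 (h2.imp fun hab => hmono hab)) h
  rw [List.length_map] at this
  omega

end ListComplex

/-! ### Group actions on sequences -/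

section ListAction

variable {F G ι α β : Type*} [Field F] [Fintype ι]

/-- The letterwise action on sequences. -/
instance listMulAction [Monoid G] [MulAction G α] : MulAction G (List α) where
  smul g l := l.map (g • ·)
  one_smul l := by
    change l.map (fun a => (1 : G) • a) = l
    simp
  mul_smul g h l := by
    change l.map (fun a => (g * h) • a) = (l.map (h • ·)).map (g • ·)
    simp [mul_smul]

theorem smul_list_def [Monoid G] [MulAction G α] (g : G) (l : List α) :
    g • l = l.map (g • ·) := rfl

theorem translate_list [Monoid G] [MulAction G α] (g : G) :
    translate F (List α) g = mapL F (g • · : α → α) := rfl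

theorem shift_pow_bd [Monoid G] [MulAction G α] (a : ι → F) (γ : ι → G) (e : ℕ)
    (x : List α →₀ F) :
    bd F α ((shift a γ (List α) ^ e) x) = (shift a γ (List α) ^ e) (bd F α x) :=
  shift_pow_comm_of_equivariant a γ (bd F α) (fun g l => by
    rw [bd_single, bd_single, one_smul, one_smul, smul_list_def, bdList_map, translate_list]) e x

theorem shift_pow_nondeg [Group G] [MulAction G α] (a : ι → F) (γ : ι → G) (e : ℕ)
    (x : List α →₀ F) :
    nondeg F α ((shift a γ (List α) ^ e) x) = (shift a γ (List α) ^ e) (nondeg F α x) :=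
  shift_pow_comm_of_equivariant a γ (nondeg F α) (fun g l => by
    have h : (g • l).IsChain (· ≠ ·) ↔ l.IsChain (· ≠ ·) := by
      rw [smul_list_def, List.isChain_map]
      simp
    by_cases hl : l.IsChain (· ≠ ·)
    · rw [nondeg_single_of_isChain hl, nondeg_single_of_isChain (h.2 hl), translate_single]
    · rw [nondeg_single_of_not_isChain hl, nondeg_single_of_not_isChain (mt h.1 hl), map_zero]) e x

theorem shift_pow_mapL [Monoid G] [MulAction G α] [MulAction G β] (a : ι → F) (γ : ι → G)
    (ψ : α → β) (hψ : ∀ (g : G) x, ψ (g • x) = g • ψ x) (e : ℕ) (x : List α →₀ F) :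
    mapL F ψ ((shift a γ (List α) ^ e) x) = (shift a γ (List β) ^ e) (mapL F ψ x) :=
  shift_pow_comm_of_equivariant a γ (mapL F ψ) (fun g l => by
    simp [smul_list_def, translate_single, Function.comp_def, hψ]) e x

theorem shift_pow_mem_supported {S : Type*} [Monoid G] [MulAction G S] (a : ι → F) (γ : ι → G)
    {P : Set S} (hP : ∀ (g : G), ∀ s ∈ P, g • s ∈ P) (e : ℕ) {x : S →₀ F}
    (hx : x ∈ Finsupp.supported F F P) :
    (shift a γ S ^ e) x ∈ Finsupp.supported F F P := by
  induction e with
  | zero => simpa using hx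
  | succ e ih =>
    rw [pow_succ', Module.End.mul_apply, shift, LinearMap.sum_apply]
    refine Submodule.sum_mem _ fun i _ => ?_
    rw [LinearMap.smul_apply, LinearMap.sub_apply]
    refine Submodule.smul_mem _ _ (sub_mem (map_mem_supported _ (fun s hs => ?_) ih) ih)
    rw [translate_single]
    exact Finsupp.single_mem_supported F _ (hP _ s hs)

theorem shift_apply_of_fixed {S : Type*} [Group G] [MulAction G S] (a : ι → F) (γ : ι → G) (s : S)
    (hs : ∀ g : G, g • s = s) (x : S →₀ F) : shift a γ S x s = 0 := by
  have h : ∀ g : G, translate F S g x s = x s := by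
    intro g
    conv_lhs => rw [← hs g]
    exact Finsupp.mapDomain_apply (MulAction.injective g) x s
  rw [shift, LinearMap.sum_apply, Finsupp.finsetSum_apply]
  refine Finset.sum_eq_zero fun i _ => ?_
  rw [LinearMap.smul_apply, LinearMap.sub_apply, Finsupp.smul_apply, Finsupp.sub_apply, h]
  simp

end ListAction

/-! ### Towers of chains subordinate to covers -/

section Tower

variable {F : Type*} [Field F] {p k : ℕ} [Fact p.Prime] [Algebra (ZMod p) F]
  {Y : Type*} [MulAction (Multiplicative (Fin k → ZMod p)) Y]

theorem shift_pow_expo_succ_shift_pow_expo {S : Type*}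
    [MulAction (Multiplicative (Fin k → ZMod p)) S] (a : Fin k → F) (i : ℕ) (x : S →₀ F) :
    (shift a (gen p k) S ^ expo p (i + 1)) ((shift a (gen p k) S ^ expo p i) x) = 0 := by
  have : CharP F p := charP_of_injective_algebraMap (algebraMap (ZMod p) F).injective p
  rw [← Module.End.mul_apply, ← pow_add, add_comm, expo_add_expo_succ,
    shift_pow_eq_zero p a _ gen_pow, LinearMap.zero_apply]

/-- The nonempty sets all of whose translates are subordinate to `𝒱`. -/
def small (p k : ℕ) {Y : Type*} [MulAction (Multiplicative (Fin k → ZMod p)) Y]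
    (𝒱 : Set (Set Y)) : Set (Set Y) :=
  {A | A.Nonempty ∧ ∀ g : Multiplicative (Fin k → ZMod p), ∃ V ∈ 𝒱, g • A ⊆ V}

theorem smul_mem_small {𝒱 : Set (Set Y)} (g : Multiplicative (Fin k → ZMod p)) {A : Set Y}
    (hA : A ∈ small p k 𝒱) : g • A ∈ small p k 𝒱 :=
  ⟨hA.1.smul_set, fun h => by rw [← mul_smul]; exact hA.2 _⟩

theorem exists_subset_of_mem_small {𝒱 : Set (Set Y)} {A : Set Y} (hA : A ∈ small p k 𝒱) :
    ∃ V ∈ 𝒱, A ⊆ V := by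
  simpa using hA.2 1

theorem smul_mem_decLists_small {𝒱 : Set (Set Y)} {m : ℕ} (g : Multiplicative (Fin k → ZMod p))
    (l : List (Set Y)) (hl : l ∈ decLists (small p k 𝒱) m) :
    g • l ∈ decLists (small p k 𝒱) m := by
  obtain ⟨h1, h2, h3⟩ := hl
  refine ⟨by simpa [smul_list_def] using h1, ?_, ?_⟩
  · rw [smul_list_def, List.pairwise_map]
    exact h2.imp fun hab => Set.smul_set_mono hab
  · rw [smul_list_def]
    simp only [List.mem_map, forall_exists_index, and_imp, forall_apply_eq_imp_iff₂]
    exact fun A hA => smul_mem_small g (h3 A hA)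

/-- For every open cover, a piece up to degree `j` of an equivariant resolution by chains of small
decreasing sequences of sets. -/
def HasTower (a : Fin k → F) (j : ℕ) (Y : Type*) [TopologicalSpace Y]
    [MulAction (Multiplicative (Fin k → ZMod p)) Y] : Prop :=
  ∀ 𝒱 : Set (Set Y), (∀ V ∈ 𝒱, IsOpen V) → ⋃₀ 𝒱 = Set.univ → ∃ w : ℕ → (List (Set Y) →₀ F),
    (∀ i ≤ j, w i ∈ Finsupp.supported F F (decLists (small p k 𝒱) (i + 1))) ∧
    bd F _ (w 0) = Finsupp.single [] 1 ∧
    ∀ i < j, nondeg F _ (bd F _ (w (i + 1))) =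
      nondeg F _ ((shift a (gen p k) (List (Set Y)) ^ expo p i) (w i))

/-- Every open cover has an open refinement whose nerve has dimension at most `n`, in a
combinatorial form. -/
def HasRankedRefinements (n : ℕ) (Y : Type*) [TopologicalSpace Y] : Prop :=
  ∀ 𝒲 : Set (Set Y), (∀ W ∈ 𝒲, IsOpen W) → ⋃₀ 𝒲 = Set.univ →
    ∃ 𝒱 : Set (Set Y), (∀ V ∈ 𝒱, IsOpen V) ∧ ⋃₀ 𝒱 = Set.univ ∧
    ∃ (ψ : Set Y → Set Y) (ρ : Set Y → ℕ), Monotone ψ ∧ (∀ A, A ⊆ ψ A) ∧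
      (∀ A, A.Nonempty → (∃ V ∈ 𝒱, A ⊆ V) → ∃ W ∈ 𝒲, ψ A ⊆ W) ∧
      (∀ A, A.Nonempty → ρ (ψ A) ≤ n) ∧
      ∀ A B, A.Nonempty → B.Nonempty → (∃ V ∈ 𝒱, A ⊆ V) → (∃ V ∈ 𝒱, B ⊆ V) → ψ B < ψ A →
        ρ (ψ A) < ρ (ψ B)

theorem HasTower.succ [TopologicalSpace Y] {a : Fin k → F} {n j : ℕ} (hY : HasRankedRefinements n Y)
    (hcont : ∀ g : Multiplicative (Fin k → ZMod p), Continuous fun y : Y => g • y)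
    (hj : n + 1 ≤ j) (h : HasTower (p := p) a j Y) : HasTower (p := p) a (j + 1) Y := by
  intro 𝒰 hUo hUc
  have hp0 : NeZero p := ⟨(Fact.out : p.Prime).ne_zero⟩
  let 𝒲 : Set (Set Y) :=
    {O | IsOpen O ∧ ∀ g : Multiplicative (Fin k → ZMod p), ∃ U ∈ 𝒰, g • O ⊆ U}
  have hWc : ⋃₀ 𝒲 = Set.univ := by
    refine Set.eq_univ_of_forall fun y => ?_
    have hyU : ∀ g : Multiplicative (Fin k → ZMod p), ∃ U ∈ 𝒰, g • y ∈ U := fun g => by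
      have : g • y ∈ ⋃₀ 𝒰 := hUc ▸ Set.mem_univ _
      simpa using this
    choose U hU hyU using hyU
    have : Finite (Multiplicative (Fin k → ZMod p)) :=
      inferInstanceAs (Finite (Fin k → ZMod p))
    refine ⟨⋂ g : Multiplicative (Fin k → ZMod p), (fun y => g • y) ⁻¹' U g,
      ⟨isOpen_iInter_of_finite fun g => (hUo _ (hU g)).preimage (hcont g),
        fun g => ⟨U g, hU g, ?_⟩⟩,
      Set.mem_iInter.2 hyU⟩
    rintro _ ⟨z, hz, rfl⟩
    exact Set.mem_iInter.1 hz g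
  obtain ⟨𝒱, hVo, hVc, ψ, ρ, hmono, hle, hψ, hρn, hρ⟩ := hY 𝒲 (fun W hW => hW.1) hWc
  obtain ⟨w, hw1, hw2, hw3⟩ := h 𝒱 hVo hVc
  set t := shift a (gen p k) (List (Set Y)) with ht
  have hsm : ∀ A ∈ small p k 𝒱, ψ A ∈ small p k 𝒰 := by
    intro A hA
    obtain ⟨W, hW, hAW⟩ := hψ A hA.1 (exists_subset_of_mem_small hA)
    refine ⟨hA.1.mono (hle A), fun g => ?_⟩
    obtain ⟨U, hU, hWU⟩ := hW.2 g
    exact ⟨U, hU, (Set.smul_set_mono hAW).trans hWU⟩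
  have hsub : small p k 𝒱 ⊆ small p k 𝒰 := fun A hA =>
    ⟨hA.1, fun g => by
      obtain ⟨U, hU, h⟩ := (hsm A hA).2 g
      exact ⟨U, hU, (Set.smul_set_mono (hle A)).trans h⟩⟩
  have hz : (t ^ expo p j) (w j) ∈ Finsupp.supported F F (decLists (small p k 𝒱) (j + 1)) :=
    shift_pow_mem_supported a _ smul_mem_decLists_small _ (hw1 j le_rfl)
  refine ⟨Function.update w (j + 1) (prism F ψ ((t ^ expo p j) (w j))), ?_, ?_, ?_⟩
  · intro i hi
    rcases hi.eq_or_lt with rfl | hi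
    · rw [Function.update_self]
      exact prism_mem_supported ψ hmono hle hsub hsm hz
    · rw [Function.update_of_ne hi.ne]
      refine Finsupp.supported_mono ?_ (hw1 i (by omega))
      rintro l ⟨h1, h2, h3⟩
      exact ⟨h1, h2, fun A hA => hsub (h3 A hA)⟩
  · rw [Function.update_of_ne (by omega), hw2]
  · intro i hi
    rcases (Nat.lt_succ_iff.1 hi).eq_or_lt with rfl | hi
    · rw [Function.update_self, Function.update_of_ne (by omega), bd_prism, map_sub, map_sub,
        nondeg_mapL_eq_zero ψ hmono ρ n (fun A hA => hρn A hA.1)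
          (fun A hA B hB => hρ A B hA.1 hB.1 (exists_subset_of_mem_small hA)
            (exists_subset_of_mem_small hB)) (by omega) hz,
        sub_zero, sub_eq_self, ← nondeg_prism_nondeg]
      obtain ⟨i, rfl⟩ : ∃ i', i = i' + 1 := ⟨i - 1, by omega⟩
      rw [shift_pow_bd, shift_pow_nondeg, hw3 i (by omega), ← shift_pow_nondeg, ht,
        shift_pow_expo_succ_shift_pow_expo]
      simp
    · rw [Function.update_of_ne (by omega), Function.update_of_ne (by omega)]
      exact hw3 i hi

theorem HasTower.of_le [TopologicalSpace Y] {a : Fin k → F} {n : ℕ} (hY : HasRankedRefinements n Y)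
    (hcont : ∀ g : Multiplicative (Fin k → ZMod p), Continuous fun y : Y => g • y)
    (h : HasTower (p := p) a (n + 1) Y) (j : ℕ) (hj : n + 1 ≤ j) : HasTower (p := p) a j Y := by
  induction j, hj using Nat.le_induction with
  | base => exact h
  | succ j hj ih => exact ih.succ hY hcont hj

end Tower

/-! ### No towers of unbounded height -/

section Contradiction

variable {F : Type*} [Field F] {p k : ℕ} [Fact p.Prime] [Algebra (ZMod p) F]
  {Y : Type*} [TopologicalSpace Y] [MulAction (Multiplicative (Fin k → ZMod p)) Y]

theorem exists_finite_invariant_cover [CompactSpace Y] [T2Space Y]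
    (hcont : ∀ g : Multiplicative (Fin k → ZMod p), Continuous fun y : Y => g • y)
    (hfree : ¬ ∃ y : Y, ∀ g : Multiplicative (Fin k → ZMod p), g • y = y) :
    ∃ 𝒰 : Set (Set Y), 𝒰.Finite ∧ (∀ U ∈ 𝒰, IsOpen U) ∧ ⋃₀ 𝒰 = Set.univ ∧
      (∀ g : Multiplicative (Fin k → ZMod p), ∀ U ∈ 𝒰, g • U ∈ 𝒰) ∧
      ∀ U ∈ 𝒰, ∃ g : Multiplicative (Fin k → ZMod p), Disjoint (g • U) U := by
  have hp0 : NeZero p := ⟨(Fact.out : p.Prime).ne_zero⟩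
  have : Finite (Multiplicative (Fin k → ZMod p)) := inferInstanceAs (Finite (Fin k → ZMod p))
  have : ContinuousConstSMul (Multiplicative (Fin k → ZMod p)) Y := ⟨hcont⟩
  push Not at hfree
  have hO : ∀ y : Y, ∃ O : Set Y, IsOpen O ∧ y ∈ O ∧
      ∃ g : Multiplicative (Fin k → ZMod p), Disjoint (g • O) O := by
    intro y
    obtain ⟨g, hg⟩ := hfree y
    obtain ⟨A, B, hA, hB, hyA, hyB, hAB⟩ := t2_separation hg
    refine ⟨B ∩ (fun y => g • y) ⁻¹' A, hB.inter (hA.preimage (hcont g)), ⟨hyB, hyA⟩, g,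
      hAB.mono ?_ Set.inter_subset_left⟩
    rintro _ ⟨z, hz, rfl⟩
    exact hz.2
  choose O hOo hyO hOg using hO
  obtain ⟨s, hs⟩ := isCompact_univ.elim_finite_subcover O hOo
    fun y _ => Set.mem_iUnion.2 ⟨y, hyO y⟩
  refine ⟨Set.range fun q : Multiplicative (Fin k → ZMod p) × s => q.1 • O q.2,
    Set.finite_range _, ?_, ?_, ?_, ?_⟩
  · rintro _ ⟨q, rfl⟩
    exact (hOo _).smul _
  · refine Set.eq_univ_of_forall fun y => ?_
    obtain ⟨z, hz, hy⟩ := Set.mem_iUnion₂.1 (hs (Set.mem_univ y))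
    exact ⟨O z, ⟨(1, ⟨z, hz⟩), one_smul _ _⟩, hy⟩
  · rintro g _ ⟨q, rfl⟩
    exact ⟨(g * q.1, q.2), mul_smul _ _ _⟩
  · rintro _ ⟨q, rfl⟩
    obtain ⟨g, hg⟩ := hOg q.2
    refine ⟨g, ?_⟩
    rw [smul_comm g q.1]
    exact Set.disjoint_smul_set.2 hg

theorem not_hasTower_of_rank {a : Fin k → F} (ha : LinearIndependent (ZMod p) a) {M : ℕ}
    (𝒰 : Set (Set Y)) (hUo : ∀ U ∈ 𝒰, IsOpen U) (hUc : ⋃₀ 𝒰 = Set.univ)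
    (ψ : Set Y → Set Y) (ρ : Set Y → ℕ) (hmono : Monotone ψ)
    (hequiv : ∀ (g : Multiplicative (Fin k → ZMod p)) A, ψ (g • A) = g • ψ A)
    (hψ : ∀ A ∈ small p k 𝒰, ∃ g : Multiplicative (Fin k → ZMod p), g • ψ A ≠ ψ A)
    (hρM : ∀ A, ρ A ≤ M) (hρ : ∀ A B, ψ B < ψ A → ρ (ψ A) < ρ (ψ B)) :
    ¬ HasTower (p := p) a (M + 1) Y := by
  intro h
  obtain ⟨w, hw1, hw2, hw3⟩ := h 𝒰 hUo hUc
  set t := shift a (gen p k) (List (Set Y)) with ht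
  let N : Set (Set Y) := {A | ∃ g : Multiplicative (Fin k → ZMod p), g • A ≠ A}
  let P : ℕ → Set (List (Set Y)) := fun m => {l | l.length = m ∧ ∀ A ∈ l, A ∈ N}
  have hN : ∀ (g : Multiplicative (Fin k → ZMod p)), ∀ A ∈ N, g • A ∈ N := by
    rintro g A ⟨h, hh⟩
    refine ⟨h, fun h' => hh ?_⟩
    rw [smul_comm] at h'
    exact MulAction.injective g h'
  have hP : ∀ m (g : Multiplicative (Fin k → ZMod p)), ∀ l ∈ P m, g • l ∈ P m := by
    rintro m g l ⟨h1, h2⟩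
    refine ⟨by simpa [smul_list_def] using h1, ?_⟩
    rw [smul_list_def]
    simp only [List.mem_map, forall_exists_index, and_imp, forall_apply_eq_imp_iff₂]
    exact fun A hA => hN g A (h2 A hA)
  have hPfree : ∀ m, ¬ ∃ l ∈ P (m + 1),
      ∀ g : Multiplicative (Fin k → ZMod p), g • l = l := by
    rintro m ⟨l, ⟨h1, h2⟩, h3⟩
    rcases l with _ | ⟨A, l⟩
    · simp at h1
    · obtain ⟨g, hg⟩ := h2 A (by simp)
      have := h3 g
      rw [smul_list_def, List.map_cons, List.cons.injEq] at this
      exact hg this.1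
  have hnd : ∀ m x, x ∈ Finsupp.supported F F (P m) →
      nondeg F _ x ∈ Finsupp.supported F F (P m) := by
    intro m x hx
    refine map_mem_supported _ (fun l hl => ?_) hx
    by_cases hc : l.IsChain (· ≠ ·)
    · rw [nondeg_single_of_isChain hc]
      exact Finsupp.single_mem_supported F _ hl
    · rw [nondeg_single_of_not_isChain hc]
      exact zero_mem _
  have hbdl : ∀ (l : List (Set Y)) (m : ℕ), l ∈ P (m + 1) →
      bdList F l ∈ Finsupp.supported F F (P m) := by
    intro l
    induction l with
    | nil => intro m _; exact zero_mem _
    | cons A l ih =>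
      rintro m ⟨h1, h2⟩
      rw [List.forall_mem_cons] at h2
      have hl : l.length = m := by simpa using h1
      rw [bdList]
      refine sub_mem (Finsupp.single_mem_supported F _ ⟨hl, h2.2⟩) ?_
      rcases m with _ | m
      · rw [List.length_eq_zero_iff] at hl
        subst hl
        rw [bdList, map_zero]
        exact zero_mem _
      · refine map_mem_supported _ (fun l' hl' => ?_) (ih m ⟨hl, h2.2⟩)
        rw [consL_single]
        exact Finsupp.single_mem_supported F _
          ⟨by simp [hl'.1], List.forall_mem_cons.2 ⟨h2.1, hl'.2⟩⟩
  have hbd : ∀ m x, x ∈ Finsupp.supported F F (P (m + 1)) →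
      bd F _ x ∈ Finsupp.supported F F (P m) := fun m x hx =>
    map_mem_supported _ (fun l hl => by
      rw [bd_single, one_smul]
      exact hbdl l m hl) hx
  set w' : ℕ → (List (Set Y) →₀ F) := fun i => nondeg F _ (mapL F ψ (w i)) with hw'
  have hw'P : ∀ i ≤ M + 1, w' i ∈ Finsupp.supported F F (P (i + 1)) := by
    intro i hi
    refine hnd _ _ (map_mem_supported _ ?_ (hw1 i hi))
    rintro l ⟨h1, -, h3⟩
    rw [mapL_single]
    refine Finsupp.single_mem_supported F _ ⟨by simpa using h1, ?_⟩
    simp only [List.mem_map, forall_exists_index, and_imp, forall_apply_eq_imp_iff₂]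
    exact fun A hA => hψ A (h3 A hA)
  have hw'bd : ∀ i < M + 1, nondeg F _ (bd F _ (w' (i + 1))) = (t ^ expo p i) (w' i) := by
    intro i hi
    rw [hw', nondeg_bd_nondeg, bd_mapL, ← nondeg_mapL_nondeg, hw3 i hi, nondeg_mapL_nondeg,
      shift_pow_mapL a _ ψ hequiv, shift_pow_nondeg]
  have hbb : ∀ x : List (Set Y) →₀ F, nondeg F _ (bd F _ (nondeg F _ (bd F _ x))) = 0 := by
    intro x
    have : bd F (Set Y) ∘ₗ bd F (Set Y) = 0 := by
      ext l : 2
      simp [bd_bdList]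
    rw [nondeg_bd_nondeg, ← LinearMap.comp_apply (bd F (Set Y)), this]
    simp
  have key : ∀ i ≤ M + 1, ∃ u v : List (Set Y) →₀ F, v ∈ Finsupp.supported F F (P (i + 1)) ∧
      w' i = nondeg F _ (bd F _ u) + (t ^ expo p (i + 1)) v := by
    intro i hi
    induction hi using Nat.decreasingInduction with
    | self =>
      refine ⟨0, 0, zero_mem _, ?_⟩
      have := nondeg_mapL_eq_zero (F := F) ψ hmono (Q := small p k 𝒰) ρ M (fun A _ => hρM _)
        (fun A _ B _ => hρ A B) (m := M + 1 + 1) (by omega) (hw1 (M + 1) le_rfl)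
      simp [hw', this]
    | of_succ i hi ih =>
      obtain ⟨u, v, hv, huv⟩ := ih
      have h1 := hw'bd i hi
      have he : expo p (i + 1 + 1) = expo p i := by simp [expo, Nat.even_add_one]
      rw [huv, map_add, map_add, hbb, zero_add, he, shift_pow_bd, shift_pow_nondeg] at h1
      have h2 := hnd _ _ (hbd _ _ hv)
      obtain ⟨v', hv', hv'2⟩ := exists_shift_pow_eq_of_support a ha (P (i + 1)) (hP (i + 1))
        (hPfree i) i (w' i - nondeg F _ (bd F _ v)) (fun l hl => sub_mem (hw'P i hi.le) h2 hl)
        (by rw [map_sub, ← ht, ← h1, sub_self])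
      exact ⟨v, v', hv', by rw [ht, hv'2]; abel⟩
  obtain ⟨u, v, -, huv⟩ := key 0 (Nat.zero_le _)
  have h0 := congrArg (fun x => nondeg F _ (bd F _ x) []) huv
  simp only [hw'] at h0
  rw [nondeg_bd_nondeg, bd_mapL, hw2, map_add, map_add, hbb, zero_add, mapL_single, List.map_nil,
    nondeg_single_of_isChain (by simp), Finsupp.single_eq_same, shift_pow_bd, shift_pow_nondeg,
    ← Nat.succ_pred_eq_of_pos (expo_pos (p := p) (0 + 1)), Nat.succ_eq_add_one, pow_succ',
    Module.End.mul_apply, shift_apply_of_fixed a _ [] (fun g => rfl)] at h0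
  exact one_ne_zero h0

theorem exists_forall_not_hasTower [CompactSpace Y] [T2Space Y] {a : Fin k → F}
    (ha : LinearIndependent (ZMod p) a)
    (hcont : ∀ g : Multiplicative (Fin k → ZMod p), Continuous fun y : Y => g • y)
    (hfree : ¬ ∃ y : Y, ∀ g : Multiplicative (Fin k → ZMod p), g • y = y) :
    ∃ M, ∀ j, M < j → ¬ HasTower (p := p) a j Y := by
  obtain ⟨𝒰, hfin, hUo, hUc, hinv, hdisj⟩ := exists_finite_invariant_cover hcont hfree
  refine ⟨𝒰.ncard, fun j hj => ?_⟩
  obtain ⟨M, rfl⟩ : ∃ M, j = M + 1 := ⟨j - 1, by omega⟩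
  let ψ : Set Y → Set Y := fun A => ⋂₀ {U ∈ 𝒰 | A ⊆ U}
  have hle : ∀ A, A ⊆ ψ A := fun A => Set.subset_sInter fun U hU => hU.2
  have hmono : Monotone ψ := fun A B hAB =>
    Set.sInter_subset_sInter fun U hU => ⟨hU.1, hAB.trans hU.2⟩
  have hset : ∀ A B, {U ∈ 𝒰 | A ⊆ U} = {U ∈ 𝒰 | B ⊆ U} → ψ A = ψ B := fun A B h => by
    simp only [ψ, h]
  have hψψ : ∀ A, ψ (ψ A) = ψ A := fun A =>
    Set.Subset.antisymm (Set.subset_sInter fun U hU => Set.sInter_subset_of_mem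
      (show U ∈ {U ∈ 𝒰 | ψ A ⊆ U} from ⟨hU.1, Set.sInter_subset_of_mem hU⟩)) (hle _)
  refine not_hasTower_of_rank ha 𝒰 hUo hUc ψ (fun A => {U ∈ 𝒰 | A ⊆ U}.ncard) hmono ?_ ?_ ?_ ?_
  · have hsub : ∀ (g : Multiplicative (Fin k → ZMod p)) A, g • ψ A ⊆ ψ (g • A) := by
      intro g A
      refine Set.subset_sInter fun U hU => ?_
      rw [Set.smul_set_subset_iff_subset_inv_smul_set]
      exact Set.sInter_subset_of_mem ⟨hinv _ _ hU.1, by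
        rw [← Set.smul_set_subset_iff_subset_inv_smul_set]
        exact hU.2⟩
    intro g A
    refine Set.Subset.antisymm ?_ (hsub g A)
    rw [Set.subset_smul_set_iff]
    simpa using hsub g⁻¹ (g • A)
  · intro A hA
    obtain ⟨U, hU, hAU⟩ := exists_subset_of_mem_small hA
    obtain ⟨g, hg⟩ := hdisj U hU
    refine ⟨g, fun h => ?_⟩
    have hsub : ψ A ⊆ U := Set.sInter_subset_of_mem ⟨hU, hAU⟩
    have hd := hg.mono (Set.smul_set_mono hsub) hsub
    rw [h, disjoint_self] at hd
    exact (hA.1.mono (hle A)).ne_empty hd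
  · intro A
    exact (Set.ncard_le_ncard (Set.sep_subset _ _) hfin).trans (by omega)
  · intro A B hBA
    refine Set.ncard_lt_ncard ⟨fun U hU => ⟨hU.1, hBA.1.trans hU.2⟩, fun h => ?_⟩
      (hfin.subset (Set.sep_subset _ _))
    have := hset _ _ (h.antisymm fun U hU => ⟨hU.1, hBA.1.trans hU.2⟩)
    rw [hψψ, hψψ] at this
    exact hBA.ne this

end Contradiction

/-! ### Grid covers of the boundary of a cube -/

section Grid

variable {Y : Type*} {m : ℕ}

/-- The integers at distance less than one from the `i`-th coordinates of all points of `A`. -/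
def nearInts (φ : Y → Fin m → ℝ) (A : Set Y) (i : Fin m) : Set ℤ :=
  {z | ∀ y ∈ A, |φ y i - z| < 1}

theorem nearInts_anti (φ : Y → Fin m → ℝ) {A B : Set Y} (h : A ⊆ B) (i : Fin m) :
    nearInts φ B i ⊆ nearInts φ A i := fun _ hz y hy => hz y (h hy)

/-- The unit box around an integral point. -/
def gridBox (φ : Y → Fin m → ℝ) (v : Fin m → ℤ) : Set Y := {y | ∀ i, |φ y i - v i| < 1}

theorem subset_gridBox_iff (φ : Y → Fin m → ℝ) (A : Set Y) (v : Fin m → ℤ) :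
    A ⊆ gridBox φ v ↔ ∀ i, v i ∈ nearInts φ A i :=
  ⟨fun h i _ hy => h hy i, fun h _ hy i => h i _ hy⟩

/-- The intersection of all grid boxes containing `A`. -/
def gridHull (φ : Y → Fin m → ℝ) (A : Set Y) : Set Y :=
  {y | ∀ v, (∀ i, v i ∈ nearInts φ A i) → y ∈ gridBox φ v}

theorem subset_gridHull (φ : Y → Fin m → ℝ) (A : Set Y) : A ⊆ gridHull φ A :=
  fun _ hy v hv => (subset_gridBox_iff φ A v).2 hv hy

theorem gridHull_subset_gridBox (φ : Y → Fin m → ℝ) {A : Set Y} {v : Fin m → ℤ}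
    (h : A ⊆ gridBox φ v) : gridHull φ A ⊆ gridBox φ v :=
  fun _ hy => hy v ((subset_gridBox_iff φ A v).1 h)

theorem gridHull_mono (φ : Y → Fin m → ℝ) : Monotone (gridHull φ) :=
  fun _ _ hAB _ hy v hv => hy v fun i => nearInts_anti φ hAB i (hv i)

theorem gridHull_gridHull (φ : Y → Fin m → ℝ) (A : Set Y) :
    gridHull φ (gridHull φ A) = gridHull φ A :=
  Set.Subset.antisymm (fun _ hy v hv => gridHull_subset_gridBox φ
    (gridHull_subset_gridBox φ ((subset_gridBox_iff φ A v).2 hv)) hy) (subset_gridHull φ _)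

open Classical in
/-- The number of coordinates in which the grid boxes containing `A` vary. -/
def gridRank (φ : Y → Fin m → ℝ) (A : Set Y) : ℕ :=
  (Finset.univ.filter fun i => (nearInts φ A i).Nontrivial).card

theorem gridRank_le (φ : Y → Fin m → ℝ) {A : Set Y} {y : Y} (hy : y ∈ A) {i : Fin m} {z : ℤ}
    (hz : φ y i = z) : gridRank φ A + 1 ≤ m := by
  classical
  have : i ∉ Finset.univ.filter fun i => (nearInts φ A i).Nontrivial := by
    simp only [Finset.mem_filter, Finset.mem_univ, true_and, Set.not_nontrivial_iff]
    have h : ∀ a ∈ nearInts φ A i, a = z := by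
      intro a ha
      have := ha y hy
      rw [hz, ← Int.cast_sub, ← Int.cast_abs] at this
      have h1 : |z - a| < 1 := by exact_mod_cast this
      have := Int.abs_lt_one_iff.1 h1
      omega
    exact fun a ha b hb => (h a ha).trans (h b hb).symm
  have := Finset.card_lt_univ_of_notMem this
  rw [Fintype.card_fin] at this
  unfold gridRank
  omega

theorem gridRank_lt (φ : Y → Fin m → ℝ) {A B : Set Y} (hA : A.Nonempty) {v : Fin m → ℤ}
    (hB : B ⊆ gridBox φ v) (hAB : A ⊆ B) (hne : gridHull φ A ≠ gridHull φ B) :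
    gridRank φ B < gridRank φ A := by
  classical
  have hsub : (Finset.univ.filter fun i => (nearInts φ B i).Nontrivial) ⊆
      Finset.univ.filter fun i => (nearInts φ A i).Nontrivial := by
    intro i hi
    simp only [Finset.mem_filter, Finset.mem_univ, true_and] at hi ⊢
    exact hi.mono (nearInts_anti φ hAB i)
  by_contra hlt
  have heq := Finset.eq_of_subset_of_card_le hsub (not_lt.1 hlt)
  apply hne
  have : nearInts φ A = nearInts φ B := by
    funext i
    refine Set.Subset.antisymm ?_ (nearInts_anti φ hAB i)
    have hi : (nearInts φ B i).Nontrivial ↔ (nearInts φ A i).Nontrivial := by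
      simpa using Finset.ext_iff.1 heq i
    have hvi := (subset_gridBox_iff φ B v).1 hB i
    by_cases hn : (nearInts φ A i).Nontrivial
    · obtain ⟨a, ha, b, hb, hab⟩ := hi.2 hn
      intro c hc
      obtain ⟨y, hy⟩ := hA
      have near : ∀ s t : ℤ, |φ y i - s| < 1 → |φ y i - t| < 1 → s < t + 2 := by
        intro s t hs ht
        have : (s : ℝ) < (t + 2 : ℤ) := by
          push_cast
          linarith [(abs_lt.1 hs).1, (abs_lt.1 ht).2]
        exact_mod_cast this
      have hay := ha y (hAB hy)
      have hby := hb y (hAB hy)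
      have hcy := hc y hy
      have hc' : c = a ∨ c = b := by
        have := near a b hay hby
        have := near b a hby hay
        have := near a c hay hcy
        have := near c a hcy hay
        have := near b c hby hcy
        have := near c b hcy hby
        omega
      rcases hc' with rfl | rfl
      exacts [ha, hb]
    · rw [Set.not_nontrivial_iff] at hn
      intro c hc
      rw [hn hc (nearInts_anti φ hAB i hvi)]
      exact hvi
  unfold gridHull
  rw [this]

theorem hasRankedRefinements_of_coordinates [TopologicalSpace Y] [CompactSpace Y] {n : ℕ}
    (φ : Y → Fin (n + 1) → ℝ) (hφ : Continuous φ) (hinj : Function.Injective φ)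
    (hone : ∀ y, ∃ i, |φ y i| = 1) : HasRankedRefinements n Y := by
  intro 𝒲 hWo hWc
  have hind := (hφ.isClosedEmbedding hinj).isInducing
  have hex : ∀ W : 𝒲, ∃ W' : Set (Fin (n + 1) → ℝ), IsOpen W' ∧ φ ⁻¹' W' = W :=
    fun W => hind.isOpen_iff.1 (hWo W W.2)
  choose O hOo hO using hex
  obtain ⟨δ, hδ, hδO⟩ := lebesgue_number_lemma_of_metric (isCompact_range hφ) hOo (by
    rintro _ ⟨y, rfl⟩
    have : y ∈ ⋃₀ 𝒲 := hWc ▸ Set.mem_univ y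
    obtain ⟨W, hW, hy⟩ := this
    exact Set.mem_iUnion.2 ⟨⟨W, hW⟩, by
      rw [← Set.mem_preimage, hO]
      exact hy⟩)
  obtain ⟨K, hK⟩ := exists_nat_gt (2 / δ)
  have hK0 : (0 : ℝ) < K := lt_trans (by positivity) hK
  have hKδ : 2 / K < δ := by
    rw [div_lt_iff₀ hδ] at hK
    rw [div_lt_iff₀ hK0]
    linarith
  let Φ : Y → Fin (n + 1) → ℝ := fun y i => K * φ y i
  refine ⟨Set.range (gridBox Φ), ?_, ?_, gridHull Φ, gridRank Φ, gridHull_mono Φ,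
    subset_gridHull Φ, ?_, ?_, ?_⟩
  · rintro _ ⟨v, rfl⟩
    have : gridBox Φ v = ⋂ i, {y | |Φ y i - v i| < 1} := by
      ext
      simp [gridBox]
    rw [this]
    refine isOpen_iInter_of_finite fun i => isOpen_lt ?_ continuous_const
    fun_prop
  · refine Set.eq_univ_of_forall fun y => ⟨_, ⟨fun i => ⌊Φ y i⌋, rfl⟩, fun i => ?_⟩
    rw [Int.self_sub_floor, abs_of_nonneg (Int.fract_nonneg _)]
    exact Int.fract_lt_one _
  · rintro A ⟨y, hy⟩ ⟨_, ⟨v, rfl⟩, hA⟩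
    obtain ⟨W, hW⟩ := hδO (φ y) ⟨y, rfl⟩
    refine ⟨W, W.2, fun z hz => ?_⟩
    rw [← hO]
    refine hW ?_
    rw [Metric.mem_ball]
    refine lt_of_le_of_lt ((dist_pi_le_iff (by positivity)).2 fun i => ?_) hKδ
    have h1 := abs_lt.1 (hA hy i)
    have h2 := abs_lt.1 (gridHull_subset_gridBox Φ hA hz i)
    have h3 : |K * (φ z i - φ y i)| ≤ 2 := by
      rw [mul_sub, abs_le]
      constructor <;> linarith
    rw [abs_mul, abs_of_pos hK0] at h3
    rw [Real.dist_eq, le_div_iff₀ hK0]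
    linarith
  · rintro A ⟨y, hy⟩
    obtain ⟨i, hi⟩ := hone y
    obtain ⟨z, hz⟩ : ∃ z : ℤ, Φ y i = z := by
      rcases eq_or_eq_neg_of_abs_eq hi with h | h
      · exact ⟨K, by simp [Φ, h]⟩
      · exact ⟨-K, by simp [Φ, h]⟩
    have := gridRank_le Φ (subset_gridHull Φ A hy) hz
    omega
  · rintro A B - hB ⟨_, ⟨v, rfl⟩, hA⟩ - hlt
    refine gridRank_lt Φ (hB.mono (subset_gridHull Φ B)) (gridHull_subset_gridBox Φ hA) hlt.1 ?_
    rw [gridHull_gridHull, gridHull_gridHull]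
    exact hlt.ne

end Grid

theorem exists_norm_apply_eq {ι : Type*} [Fintype ι] [Nonempty ι] (v : ι → ℝ) :
    ∃ i, ‖v i‖ = ‖v‖ := by
  obtain ⟨i, -, hi⟩ := Finset.exists_mem_eq_sup Finset.univ Finset.univ_nonempty fun i => ‖v i‖₊
  exact ⟨i, by rw [Pi.norm_def, hi, coe_nnnorm]⟩

theorem hasRankedRefinements_of_homeomorph_sphere {Y : Type*} [TopologicalSpace Y] {n : ℕ}
    (h : Y ≃ₜ (Metric.sphere (0 : EuclideanSpace ℝ (Fin (n + 1))) 1 :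
      Set (EuclideanSpace ℝ (Fin (n + 1))))) : HasRankedRefinements n Y := by
  have := h.symm.compactSpace
  let x : Y → Fin (n + 1) → ℝ := fun y => WithLp.ofLp (h y : EuclideanSpace ℝ (Fin (n + 1)))
  have hx : Continuous x := by fun_prop
  have hx0 : ∀ y, ‖x y‖ ≠ 0 := by
    intro y
    rw [norm_ne_zero_iff]
    intro h0
    have h1 : ‖(h y : EuclideanSpace ℝ (Fin (n + 1)))‖ = 1 := by simp
    have h2 : (h y : EuclideanSpace ℝ (Fin (n + 1))) = 0 := by
      ext i
      exact congrFun h0 i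
    rw [h2, norm_zero] at h1
    exact zero_ne_one h1
  refine hasRankedRefinements_of_coordinates (fun y => ‖x y‖⁻¹ • x y) ?_ ?_ ?_
  · exact (hx.norm.inv₀ hx0).smul hx
  · intro y y' hyy'
    have h1 : ∀ y, ‖(h y : EuclideanSpace ℝ (Fin (n + 1)))‖ = 1 := by simp
    have h2 : (‖x y‖⁻¹ : ℝ) • (h y : EuclideanSpace ℝ (Fin (n + 1))) =
        (‖x y'‖⁻¹ : ℝ) • (h y' : EuclideanSpace ℝ (Fin (n + 1))) := by
      ext i
      exact congrFun hyy' i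
    have h3 := congrArg norm h2
    rw [norm_smul, norm_smul, h1, h1, norm_inv, norm_inv, norm_norm, norm_norm, mul_one, mul_one]
      at h3
    rw [h3] at h2
    exact h.injective (Subtype.ext (smul_right_injective _ (inv_ne_zero (hx0 y')) h2))
  · intro y
    have hn : ‖‖x y‖⁻¹ • x y‖ = 1 := by
      rw [norm_smul, norm_inv, norm_norm, inv_mul_cancel₀ (hx0 y)]
    obtain ⟨i, hi⟩ := exists_norm_apply_eq (‖x y‖⁻¹ • x y)
    exact ⟨i, by rw [← Real.norm_eq_abs, hi, hn]⟩

/-! ### Singular cubes -/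

section Cubes

variable {F : Type*} [Field F] {X : Type*} [TopologicalSpace X] {m : ℕ}

/-- The restriction of a cube to the slice where the `i`-th coordinate is `s`. -/
def face (i : Fin (m + 1)) (s : I) (q : C(Fin (m + 1) → I, X)) : C(Fin m → I, X) :=
  q.comp ⟨fun u => i.insertNth s u, by fun_prop⟩

theorem face_apply (i : Fin (m + 1)) (s : I) (q : C(Fin (m + 1) → I, X)) (u : Fin m → I) :
    face i s q u = q (i.insertNth (α := fun _ => I) s u) := rfl

theorem insertNth_succ_insertNth {α : Type*} {i j : Fin (m + 1)} (h : i ≤ j) (s t : α)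
    (u : Fin m → α) :
    j.succ.insertNth (α := fun _ => α) t (i.insertNth (α := fun _ => α) s u) =
      i.castSucc.insertNth (α := fun _ => α) s (j.insertNth (α := fun _ => α) t u) := by
  have h1 : i.castSucc.succAbove j = j.succ :=
    Fin.succAbove_of_le_castSucc _ _ (Fin.castSucc_le_castSucc_iff.2 h)
  have h2 : j.succ.succAbove i = i.castSucc :=
    Fin.succAbove_of_castSucc_lt _ _ (Fin.castSucc_lt_succ_iff.2 h)
  have h3 : ∀ l, j.succ.succAbove (i.succAbove l) = i.castSucc.succAbove (j.succAbove l) := by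
    intro l
    simp only [Fin.succAbove, Fin.lt_def, Fin.le_def, Fin.ext_iff] at h ⊢
    split_ifs <;> simp_all <;> omega
  funext l
  refine Fin.succAboveCases j.succ ?_ (fun l => ?_) l
  · rw [Fin.insertNth_apply_same]
    conv_rhs => rw [← h1]
    rw [Fin.insertNth_apply_succAbove, Fin.insertNth_apply_same]
  · rw [Fin.insertNth_apply_succAbove]
    refine Fin.succAboveCases i ?_ (fun l => ?_) l
    · rw [h2, Fin.insertNth_apply_same, Fin.insertNth_apply_same]
    · rw [h3, Fin.insertNth_apply_succAbove, Fin.insertNth_apply_succAbove,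
        Fin.insertNth_apply_succAbove]

theorem face_face_succ {i j : Fin (m + 1)} (h : i ≤ j) (s t : I) (q : C(Fin (m + 1 + 1) → I, X)) :
    face i s (face j.succ t q) = face j t (face i.castSucc s q) := by
  ext u
  rw [face_apply, face_apply, face_apply, face_apply, insertNth_succ_insertNth h]

theorem sum_sum_neg_one_pow_smul_eq_zero {A : Type*} [AddCommGroup A] [Module F A]
    (f : Fin (m + 1 + 1) → Fin (m + 1) → A)
    (hf : ∀ i j : Fin (m + 1), i ≤ j → f j.succ i = f i.castSucc j) :
    ∑ a : Fin (m + 1 + 1), ∑ b : Fin (m + 1), (-1 : F) ^ ((a : ℕ) + b) • f a b = 0 := by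
  rw [← Finset.sum_product', Finset.univ_product_univ, ← Finset.sum_add_sum_compl
    {ab : Fin (m + 1 + 1) × Fin (m + 1) | (ab.1 : ℕ) ≤ ab.2}, add_eq_zero_iff_eq_neg,
    ← Finset.sum_neg_distrib]
  refine Finset.sum_bij (fun ab h => (ab.2.succ, ab.1.castLT
    ((Finset.mem_filter.1 h).2.trans_lt ab.2.2))) ?_ ?_ ?_ ?_
  · rintro ⟨a, b⟩ h
    simp only [Finset.mem_filter, Finset.mem_univ, true_and, Finset.mem_compl] at h ⊢
    simp
    omega
  · rintro ⟨a, b⟩ h ⟨a', b'⟩ h' e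
    simp only [Prod.mk.injEq, Fin.ext_iff, Fin.val_succ, Fin.val_castLT] at e ⊢
    omega
  · rintro ⟨a, b⟩ h
    simp only [Finset.mem_filter, Finset.mem_univ, true_and, Finset.mem_compl] at h
    refine ⟨(b.castSucc, a.pred fun h0 => by simp [h0] at h), ?_, ?_⟩
    · simp only [Finset.mem_filter, Finset.mem_univ, true_and, Fin.val_castSucc, Fin.val_pred]
      omega
    · simp
  · rintro ⟨a, b⟩ h
    have h' := (Finset.mem_filter.1 h).2
    have : f b.succ (a.castLT (h'.trans_lt b.2)) = f a b := hf (a.castLT (h'.trans_lt b.2)) b h'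
    simp only [this, Fin.val_succ, Fin.val_castLT, ← neg_smul]
    congr 1
    ring

/-- The chain map induced by the restriction of cubes to a slice. -/
def faceL (F : Type*) [Field F] {X : Type*} [TopologicalSpace X] {m : ℕ} (i : Fin (m + 1)) (s : I) :
    (C(Fin (m + 1) → I, X) →₀ F) →ₗ[F] (C(Fin m → I, X) →₀ F) :=
  Finsupp.lmapDomain F F (face i s)

@[simp]
theorem faceL_single (i : Fin (m + 1)) (s : I) (q : C(Fin (m + 1) → I, X)) (r : F) :
    faceL F i s (Finsupp.single q r) = Finsupp.single (face i s q) r := by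
  simp [faceL]

theorem faceL_faceL_succ {i j : Fin (m + 1)} (h : i ≤ j) (s t : I)
    (x : C(Fin (m + 1 + 1) → I, X) →₀ F) :
    faceL F i s (faceL F j.succ t x) = faceL F j t (faceL F i.castSucc s x) := by
  have : faceL F i s ∘ₗ faceL F j.succ t = faceL F j t ∘ₗ faceL F (X := X) i.castSucc s := by
    ext q : 2
    simp [face_face_succ h]
  exact LinearMap.congr_fun this x

/-- The boundary operator on cubical chains. -/
def cubeBd (F : Type*) [Field F] (X : Type*) [TopologicalSpace X] (m : ℕ) :
    (C(Fin (m + 1) → I, X) →₀ F) →ₗ[F] (C(Fin m → I, X) →₀ F) :=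
  ∑ i : Fin (m + 1), (-1 : F) ^ (i : ℕ) • (faceL F i 1 - faceL F i 0)

theorem cubeBd_apply (x : C(Fin (m + 1) → I, X) →₀ F) :
    cubeBd F X m x = ∑ i : Fin (m + 1), (-1 : F) ^ (i : ℕ) • (faceL F i 1 x - faceL F i 0 x) := by
  simp [cubeBd]

theorem cubeBd_cubeBd (x : C(Fin (m + 1 + 1) → I, X) →₀ F) :
    cubeBd F X m (cubeBd F X (m + 1) x) = 0 := by
  rw [cubeBd_apply (m := m + 1), map_sum]
  have h : ∀ a : Fin (m + 1 + 1), cubeBd F X m ((-1 : F) ^ (a : ℕ) •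
      (faceL F a 1 x - faceL F a 0 x)) = ∑ b : Fin (m + 1), (-1 : F) ^ ((a : ℕ) + b) •
      (faceL F b 1 (faceL F a 1 x) - faceL F b 1 (faceL F a 0 x) -
      (faceL F b 0 (faceL F a 1 x) - faceL F b 0 (faceL F a 0 x))) := by
    intro a
    rw [map_smul, cubeBd_apply, Finset.smul_sum]
    refine Finset.sum_congr rfl fun b _ => ?_
    rw [smul_smul, ← pow_add, map_sub, map_sub]
  rw [Finset.sum_congr rfl fun a _ => h a]
  refine sum_sum_neg_one_pow_smul_eq_zero
    (fun a b => faceL F b 1 (faceL F a 1 x) - faceL F b 1 (faceL F a 0 x) -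
      (faceL F b 0 (faceL F a 1 x) - faceL F b 0 (faceL F a 0 x))) fun i j h => ?_
  simp only [faceL_faceL_succ h]
  abel

/-- The affine map of the interval onto its `c`-th part out of `N`. -/
def subInterval (N : ℕ) (c : Fin N) : C(I, I) where
  toFun s := ⟨(c + s) / N, by
    have := s.2
    have hc : (c : ℝ) + 1 ≤ N := by exact_mod_cast c.2
    have hN : (0 : ℝ) < N := by
      have := c.pos
      positivity
    exact ⟨by have := s.2.1; positivity, by rw [div_le_one hN]; linarith [s.2.2]⟩⟩
  continuous_toFun := by fun_prop

/-- The affine map of a cube onto one of the small cubes of its regular subdivision. -/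
def subcube (N : ℕ) (a : Fin m → Fin N) : C(Fin m → I, Fin m → I) where
  toFun u i := subInterval N (a i) (u i)
  continuous_toFun := by fun_prop

/-- The subdivision operator on cubical chains. -/
def subdiv (F : Type*) [Field F] (X : Type*) [TopologicalSpace X] (m N : ℕ) :
    (C(Fin m → I, X) →₀ F) →ₗ[F] (C(Fin m → I, X) →₀ F) :=
  Finsupp.linearCombination F fun q => ∑ a, Finsupp.single (q.comp (subcube N a)) 1

@[simp]
theorem subdiv_single (N : ℕ) (q : C(Fin m → I, X)) (r : F) :
    subdiv F X m N (Finsupp.single q r) =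
      r • ∑ a, Finsupp.single (q.comp (subcube N a)) 1 := by
  simp [subdiv]

theorem face_comp_subcube (i : Fin (m + 1)) (s : I) (q : C(Fin (m + 1) → I, X)) {N : ℕ}
    (c : Fin N) (a : Fin m → Fin N) :
    face i s (q.comp (subcube N (i.insertNth (α := fun _ => Fin N) c a))) =
      (face i (subInterval N c s) q).comp (subcube N a) := by
  ext u
  rw [face_apply, ContinuousMap.comp_apply, ContinuousMap.comp_apply, face_apply]
  congr 1
  funext j
  refine Fin.succAboveCases i ?_ (fun j => ?_) j
  · simp [subcube]
  · simp [subcube]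

theorem faceL_sub_faceL_subdiv (i : Fin (m + 1)) {N : ℕ} (hN : 0 < N)
    (x : C(Fin (m + 1) → I, X) →₀ F) :
    faceL F i 1 (subdiv F X (m + 1) N x) - faceL F i 0 (subdiv F X (m + 1) N x) =
      subdiv F X m N (faceL F i 1 x - faceL F i 0 x) := by
  have : (faceL F i 1 - faceL F i 0) ∘ₗ subdiv F X (m + 1) N =
      subdiv F X m N ∘ₗ (faceL F i 1 - faceL F i 0) := by
    ext q : 2
    simp only [LinearMap.comp_apply, Finsupp.lsingle_apply, subdiv_single, one_smul,
      LinearMap.sub_apply, map_sum, faceL_single, map_sub]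
    have h : ∀ s, ∑ a : Fin (m + 1) → Fin N,
        Finsupp.single (face i s (q.comp (subcube N a))) (1 : F) =
        ∑ a : Fin m → Fin N, ∑ c : Fin N,
          Finsupp.single ((face i (subInterval N c s) q).comp (subcube N a)) 1 := by
      intro s
      rw [← (Fin.insertNthEquiv (fun _ => Fin N) i).sum_comp, Fintype.sum_prod_type_right]
      refine Finset.sum_congr rfl fun a _ => Finset.sum_congr rfl fun c _ => ?_
      rw [← face_comp_subcube]
      rfl
    rw [Finset.sum_sub_distrib, h, h, ← Finset.sum_sub_distrib, ← Finset.sum_sub_distrib]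
    refine Finset.sum_congr rfl fun a _ => ?_
    let g : ℕ → (C(Fin m → I, X) →₀ F) := fun j =>
      Finsupp.single ((face i (Set.projIcc 0 1 zero_le_one ((j : ℝ) / N)) q).comp (subcube N a)) 1
    have hg0 : ∀ c : Fin N, subInterval N c 0 = Set.projIcc 0 1 zero_le_one ((c : ℝ) / N) := by
      intro c
      rw [← Set.projIcc_val zero_le_one (subInterval N c 0)]
      congr 1
      simp [subInterval]
    have hg1 : ∀ c : Fin N,
        subInterval N c 1 = Set.projIcc 0 1 zero_le_one (((c + 1 : ℕ) : ℝ) / N) := by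
      intro c
      rw [← Set.projIcc_val zero_le_one (subInterval N c 1)]
      congr 1
      simp [subInterval]
    simp only [hg0, hg1]
    rw [← Finset.sum_sub_distrib, Fin.sum_univ_eq_sum_range (fun c => g (c + 1) - g c),
      Finset.sum_range_sub]
    have hN' : (N : ℝ) ≠ 0 := by positivity
    simp only [g, div_self hN', Nat.cast_zero, zero_div]
    rw [Set.projIcc_of_le_left _ le_rfl, Set.projIcc_of_right_le _ le_rfl]
    rfl
  simpa using LinearMap.congr_fun this x

theorem cubeBd_subdiv {N : ℕ} (hN : 0 < N) (x : C(Fin (m + 1) → I, X) →₀ F) :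
    cubeBd F X m (subdiv F X (m + 1) N x) = subdiv F X m N (cubeBd F X m x) := by
  simp only [cubeBd_apply, faceL_sub_faceL_subdiv _ hN, map_sum, map_smul]

end Cubes

/-! ### From cubes to sequences of sets -/

section CubesToLists

variable {F : Type*} [Field F] {X : Type*} [TopologicalSpace X] {m : ℕ}

/-- The chain map sending a cube to a signed sum of flags of images of its faces. -/
def cubeToList (F : Type*) [Field F] (X : Type*) [TopologicalSpace X] :
    (m : ℕ) → (C(Fin m → I, X) →₀ F) →ₗ[F] (List (Set X) →₀ F)
  | 0 => Finsupp.linearCombination F fun q => Finsupp.single [Set.range q] 1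
  | m + 1 => Finsupp.linearCombination F fun q =>
      consL F (Set.range q) (cubeToList F X m (cubeBd F X m (Finsupp.single q 1)))

theorem cubeToList_zero_single (q : C(Fin 0 → I, X)) (r : F) :
    cubeToList F X 0 (Finsupp.single q r) = Finsupp.single [Set.range q] r := by
  simp [cubeToList]

theorem cubeToList_succ_single (q : C(Fin (m + 1) → I, X)) :
    cubeToList F X (m + 1) (Finsupp.single q 1) =
      consL F (Set.range q) (cubeToList F X m (cubeBd F X m (Finsupp.single q 1))) := by
  simp [cubeToList]

theorem bd_cubeToList_cubeBd (x : C(Fin (m + 1) → I, X) →₀ F) :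
    bd F _ (cubeToList F X m (cubeBd F X m x)) = 0 ∧
      bd F _ (cubeToList F X (m + 1) x) = cubeToList F X m (cubeBd F X m x) := by
  have step : ∀ m, (∀ x, bd F _ (cubeToList F X m (cubeBd F X m x)) = 0) →
      ∀ x, bd F _ (cubeToList F X (m + 1) x) = cubeToList F X m (cubeBd F X m x) := by
    intro m h x
    have : bd F _ ∘ₗ cubeToList F X (m + 1) = cubeToList F X m ∘ₗ cubeBd F X m := by
      ext q : 2
      simp only [LinearMap.comp_apply, Finsupp.lsingle_apply]
      rw [cubeToList_succ_single, bd_consL, h, map_zero, sub_zero]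
    exact LinearMap.congr_fun this x
  have key : ∀ m, ∀ x, bd F _ (cubeToList F X m (cubeBd F X m x)) = 0 := by
    intro m
    induction m with
    | zero =>
      intro x
      have : bd F _ ∘ₗ cubeToList F X 0 ∘ₗ cubeBd F X 0 = 0 := by
        ext q : 2
        simp [cubeBd_apply, cubeToList_zero_single, bdList]
      exact LinearMap.congr_fun this x
    | succ m ih =>
      intro x
      rw [step m ih, cubeBd_cubeBd, map_zero]
  exact ⟨key m x, step m (key m) x⟩

theorem range_face_subset (i : Fin (m + 1)) (s : I) (q : C(Fin (m + 1) → I, X)) :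
    Set.range (face i s q) ⊆ Set.range q := by
  rintro _ ⟨u, rfl⟩
  exact ⟨_, (face_apply i s q u).symm⟩

theorem cubeToList_mem_supported (q : C(Fin m → I, X)) :
    cubeToList F X m (Finsupp.single q 1) ∈
      Finsupp.supported F F (decLists {A | A.Nonempty ∧ A ⊆ Set.range q} (m + 1)) := by
  induction m with
  | zero =>
    rw [cubeToList_zero_single]
    refine Finsupp.single_mem_supported F _ ⟨rfl, List.pairwise_singleton _ _, ?_⟩
    simp [Set.range_nonempty]
  | succ m ih =>
    rw [cubeToList_succ_single]
    refine map_mem_supported _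
      (P := decLists {A | A.Nonempty ∧ A ⊆ Set.range q} (m + 1)) (fun l hl => ?_) ?_
    · rw [consL_single]
      obtain ⟨h1, h2, h3⟩ := hl
      refine Finsupp.single_mem_supported F _ ⟨by simp [h1], List.pairwise_cons.2 ⟨?_, h2⟩, ?_⟩
      · exact fun A hA => (h3 A hA).2
      · simp only [List.mem_cons, forall_eq_or_imp]
        exact ⟨⟨Set.range_nonempty _, subset_rfl⟩, h3⟩
    · have h : ∀ (i : Fin (m + 1)) (s : I),
          cubeToList F X m (faceL F i s (Finsupp.single q 1)) ∈ Finsupp.supported F F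
            (decLists {A | A.Nonempty ∧ A ⊆ Set.range q} (m + 1)) := by
        intro i s
        rw [faceL_single]
        refine Finsupp.supported_mono ?_ (ih (face i s q))
        rintro l ⟨h1, h2, h3⟩
        exact ⟨h1, h2, fun A hA => ⟨(h3 A hA).1, (h3 A hA).2.trans (range_face_subset i s q)⟩⟩
      rw [cubeBd_apply, map_sum]
      refine Submodule.sum_mem _ fun i _ => ?_
      rw [map_smul, map_sub]
      exact Submodule.smul_mem _ _ (sub_mem (h _ _) (h _ _))

section Action

variable {G : Type*} [Group G] [MulAction G X] [ContinuousConstSMul G X]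

theorem cubeBd_single_smul (g : G) (q : C(Fin (m + 1) → I, X)) :
    cubeBd F X m (Finsupp.single (g • q) 1) =
      translate F _ g (cubeBd F X m (Finsupp.single q 1)) := by
  simp only [cubeBd_apply, map_sum, map_smul, map_sub, faceL_single, translate_single]
  rfl

theorem subdiv_single_smul (N : ℕ) (g : G) (q : C(Fin m → I, X)) :
    subdiv F X m N (Finsupp.single (g • q) 1) =
      translate F _ g (subdiv F X m N (Finsupp.single q 1)) := by
  simp only [subdiv_single, map_sum, map_smul, translate_single]
  rfl

theorem cubeToList_single_smul (g : G) (q : C(Fin m → I, X)) :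
    cubeToList F X m (Finsupp.single (g • q) 1) =
      translate F _ g (cubeToList F X m (Finsupp.single q 1)) := by
  have hr : ∀ {m} (q : C(Fin m → I, X)), Set.range (g • q : C(Fin m → I, X)) = g • Set.range q :=
    fun q => by rw [ContinuousMap.coe_smul, ← Set.image_smul, ← Set.range_comp]; rfl
  induction m with
  | zero =>
    rw [cubeToList_zero_single, cubeToList_zero_single, translate_single, hr]
    rfl
  | succ m ih =>
    have h : cubeToList F X m ∘ₗ translate F _ g = translate F _ g ∘ₗ cubeToList F X m := by
      ext q : 2
      simp only [LinearMap.comp_apply, Finsupp.lsingle_apply, translate_single, ih]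
    rw [cubeToList_succ_single, cubeToList_succ_single, cubeBd_single_smul, hr,
      translate_list, mapL_consL, ← translate_list]
    exact congrArg _ (LinearMap.congr_fun h _)

theorem cubeToList_translate (g : G) (x : C(Fin m → I, X) →₀ F) :
    cubeToList F X m (translate F _ g x) = translate F _ g (cubeToList F X m x) := by
  have h : cubeToList F X m ∘ₗ translate F _ g = translate F _ g ∘ₗ cubeToList F X m := by
    ext q : 2
    simp only [LinearMap.comp_apply, Finsupp.lsingle_apply, translate_single,
      cubeToList_single_smul]
  exact LinearMap.congr_fun h x

end Action

theorem eventually_range_comp_subcube {q : C(Fin m → I, X)} {P : Set (Set X)}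
    (hP : ∀ x, ∃ O, IsOpen O ∧ x ∈ O ∧ ∀ A, A.Nonempty → A ⊆ O → A ∈ P) :
    ∀ᶠ N in Filter.atTop, ∀ a, Set.range (q.comp (subcube N a)) ∈ P := by
  choose O hO hx hOP using hP
  obtain ⟨δ, hδ, h⟩ := lebesgue_number_lemma_of_metric (s := (Set.univ : Set (Fin m → I)))
    isCompact_univ (fun x => (hO x).preimage q.continuous)
    fun u _ => Set.mem_iUnion.2 ⟨q u, hx (q u)⟩
  obtain ⟨N₀, hN₀⟩ := exists_nat_one_div_lt hδ
  filter_upwards [Filter.eventually_ge_atTop (N₀ + 1)] with N hN a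
  obtain ⟨x, hx⟩ := h (subcube N a 0) (Set.mem_univ _)
  refine hOP x _ (Set.range_nonempty _) ?_
  rintro _ ⟨u, rfl⟩
  refine hx ?_
  rw [Metric.mem_ball, dist_pi_lt_iff hδ]
  intro i
  refine lt_of_le_of_lt ?_ hN₀
  have hN' : (N₀ : ℝ) + 1 ≤ N := by exact_mod_cast hN
  have hpos : (0 : ℝ) < N := by linarith [N₀.cast_nonneg (α := ℝ)]
  calc dist (subcube N a u i) (subcube N a 0 i) = |(a i + u i : ℝ) / N - (a i + 0) / N| := rfl
    _ = (u i : ℝ) / N := by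
      rw [← sub_div, add_sub_add_left_eq_sub, sub_zero,
        abs_of_nonneg (div_nonneg (u i).2.1 hpos.le)]
    _ ≤ 1 / (N₀ + 1) := div_le_div₀ zero_le_one (u i).2.2 (by positivity) hN'

end CubesToLists

section TowerOfCubes

variable {F : Type*} [Field F] {p k : ℕ} [Fact p.Prime]
  {X : Type*} [TopologicalSpace X] [MulAction (Multiplicative (Fin k → ZMod p)) X]
  [ContinuousConstSMul (Multiplicative (Fin k → ZMod p)) X]

theorem exists_isOpen_forall_mem_small {𝒱 : Set (Set X)} (hVo : ∀ V ∈ 𝒱, IsOpen V)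
    (hVc : ⋃₀ 𝒱 = Set.univ) (x : X) :
    ∃ O, IsOpen O ∧ x ∈ O ∧ ∀ A : Set X, A.Nonempty → A ⊆ O → A ∈ small p k 𝒱 := by
  have hp0 : NeZero p := ⟨(Fact.out : p.Prime).ne_zero⟩
  have hx : ∀ g : Multiplicative (Fin k → ZMod p), ∃ V ∈ 𝒱, g • x ∈ V := fun g => by
    have : g • x ∈ ⋃₀ 𝒱 := hVc ▸ Set.mem_univ _
    simpa using this
  choose V hV hxV using hx
  have : Finite (Multiplicative (Fin k → ZMod p)) := inferInstanceAs (Finite (Fin k → ZMod p))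
  refine ⟨⋂ g : Multiplicative (Fin k → ZMod p), (fun x => g • x) ⁻¹' V g,
    isOpen_iInter_of_finite fun g => (hVo _ (hV g)).preimage (continuous_const_smul g),
    Set.mem_iInter.2 hxV, fun A hA hAO => ⟨hA, fun g => ⟨V g, hV g, ?_⟩⟩⟩
  rintro _ ⟨z, hz, rfl⟩
  exact Set.mem_iInter.1 (hAO hz) g

theorem hasTower_of_cubes (a : Fin k → F) (j : ℕ) (c : C(Fin 0 → I, X))
    (q : (i : ℕ) → (C(Fin i → I, X) →₀ F)) (h0 : q 0 = Finsupp.single c 1)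
    (h : ∀ i < j, cubeBd F X i (q (i + 1)) = (shift a (gen p k) _ ^ expo p i) (q i)) :
    HasTower (p := p) a j X := by
  intro 𝒱 hVo hVc
  have hev : ∀ᶠ N in Filter.atTop, 0 < N ∧ ∀ i ∈ Finset.range (j + 1), ∀ τ ∈ (q i).support,
      ∀ b, Set.range (τ.comp (subcube N b)) ∈ small p k 𝒱 := by
    refine (Filter.eventually_gt_atTop 0).and ((Filter.eventually_all_finset _).2 fun i _ =>
      (Filter.eventually_all_finset _).2 fun τ _ => ?_)
    exact eventually_range_comp_subcube (exists_isOpen_forall_mem_small hVo hVc)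
  obtain ⟨N, hN, hsm⟩ := hev.exists
  refine ⟨fun i => cubeToList F X i (subdiv F X i N (q i)), fun i hi => ?_, ?_, fun i hi => ?_⟩
  · refine map_mem_supported (cubeToList F X i ∘ₗ subdiv F X i N) (P := (q i).support)
      (fun τ hτ => ?_) ((Finsupp.mem_supported _ _).2 subset_rfl)
    rw [LinearMap.comp_apply, subdiv_single, one_smul, map_sum]
    refine Submodule.sum_mem _ fun b _ => Finsupp.supported_mono ?_ (cubeToList_mem_supported _)
    rintro l ⟨h1, h2, h3⟩
    refine ⟨h1, h2, fun A hA => ⟨(h3 A hA).1, fun g => ?_⟩⟩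
    obtain ⟨V, hV, hgV⟩ := (hsm i (Finset.mem_range_succ_iff.2 hi) τ hτ b).2 g
    exact ⟨V, hV, (Set.smul_set_mono (h3 A hA).2).trans hgV⟩
  · simp [h0, cubeToList_zero_single, bdList]
  · have h1 : ∀ (g : Multiplicative (Fin k → ZMod p)) (τ : C(Fin i → I, X)),
        (cubeToList F X i ∘ₗ subdiv F X i N) (Finsupp.single (g • τ) 1) =
          translate F _ g ((cubeToList F X i ∘ₗ subdiv F X i N) (Finsupp.single τ 1)) := by
      intro g τ
      rw [LinearMap.comp_apply, subdiv_single_smul, cubeToList_translate]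
      rfl
    rw [(bd_cubeToList_cubeBd _).2, cubeBd_subdiv hN, h i hi]
    exact congrArg _ (shift_pow_comm_of_equivariant a (gen p k) _ h1 (expo p i) (q i))

end TowerOfCubes

/-! ### Cones over cubes -/

section Cones

variable {F : Type*} [Field F] {X : Type*} [TopologicalSpace X] {m n : ℕ}

/-- Every compatible family of `m`-cubes with `0 < m ≤ n` is the family of faces of a cube. -/
def HasFillings (n : ℕ) (X : Type*) [TopologicalSpace X] : Prop :=
  ∀ m, m + 1 ≤ n → ∀ φ : Fin (m + 1 + 1) → I → C(Fin (m + 1) → I, X),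
    (∀ i j : Fin (m + 1), i ≤ j → ∀ s t : I, s = 0 ∨ s = 1 → t = 0 ∨ t = 1 →
      face i s (φ j.succ t) = face j t (φ i.castSucc s)) →
    ∃ τ : C(Fin (m + 1 + 1) → I, X), ∀ i s, s = 0 ∨ s = 1 → face i s τ = φ i s

/-- A choice of cones over all cubes with apex `x₀`, compatible with faces. -/
def cone (x₀ : X) : (m : ℕ) → C(Fin m → I, X) → C(Fin (m + 1) → I, X)
  | 0, q => Classical.epsilon (h := ⟨.const _ x₀⟩) fun τ =>
      face 0 1 τ = q ∧ face 0 0 τ = .const _ x₀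
  | m + 1, q => Classical.epsilon (h := ⟨.const _ x₀⟩) fun τ =>
      (face 0 1 τ = q ∧ face 0 0 τ = .const _ x₀) ∧
        ∀ i s, s = 0 ∨ s = 1 → face i.succ s τ = cone x₀ m (face i s q)

theorem face_zero_cone_zero [PathConnectedSpace X] (x₀ : X) (q : C(Fin 0 → I, X)) :
    face 0 1 (cone x₀ 0 q) = q ∧ face 0 0 (cone x₀ 0 q) = .const _ x₀ := by
  rw [cone]
  refine Classical.epsilon_spec_aux (p := fun τ => face 0 1 τ = q ∧ face 0 0 τ = .const _ x₀) _ ?_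
  obtain ⟨γ⟩ := PathConnectedSpace.joined x₀ (q 0)
  refine ⟨γ.toContinuousMap.comp ⟨fun u => u 0, by fun_prop⟩, ?_, ?_⟩
  · ext u
    rw [face_apply, Subsingleton.elim u 0]
    simp
  · ext u
    rw [face_apply]
    simp

theorem face_cone_succ [PathConnectedSpace X] (x₀ : X) (hX : HasFillings n X) (m : ℕ)
    (hm : m + 1 ≤ n) (q : C(Fin (m + 1) → I, X)) :
    (face 0 1 (cone x₀ (m + 1) q) = q ∧ face 0 0 (cone x₀ (m + 1) q) = .const _ x₀) ∧
      ∀ i s, s = 0 ∨ s = 1 → face i.succ s (cone x₀ (m + 1) q) = cone x₀ m (face i s q) := by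
  have h : ∀ q : C(Fin m → I, X), face 0 1 (cone x₀ m q) = q ∧
      face 0 0 (cone x₀ m q) = .const _ x₀ := by
    cases m with
    | zero => exact face_zero_cone_zero x₀
    | succ m => exact fun q => (face_cone_succ x₀ hX m (by omega) q).1
  rw [cone]
  refine Classical.epsilon_spec_aux (p := fun τ =>
    (face 0 1 τ = q ∧ face 0 0 τ = .const _ x₀) ∧
      ∀ i s, s = 0 ∨ s = 1 → face i.succ s τ = cone x₀ m (face i s q)) _ ?_
  obtain ⟨τ, hτ⟩ := hX m hm
    (Fin.cons (fun s => if s = 0 then .const _ x₀ else q) fun i s => cone x₀ m (face i s q)) (by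
      intro i j hij s t hs ht
      rw [Fin.cons_succ]
      rcases Fin.eq_zero_or_eq_succ i with rfl | ⟨i, rfl⟩
      · rw [Fin.castSucc_zero, Fin.cons_zero]
        rcases hs with rfl | rfl
        · rw [(h _).2, if_pos rfl]
          rfl
        · rw [(h _).1, if_neg one_ne_zero]
      · rcases Fin.eq_zero_or_eq_succ j with rfl | ⟨j, rfl⟩
        · exact absurd hij (Fin.succ_pos i).not_ge
        cases m with
        | zero => exact i.elim0
        | succ m =>
          have hc := fun q => (face_cone_succ x₀ hX m (by omega) q).2
          rw [← Fin.succ_castSucc, Fin.cons_succ, hc _ _ _ hs, hc _ _ _ ht,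
            face_face_succ (Fin.succ_le_succ_iff.1 hij)])
  refine ⟨τ, ⟨?_, ?_⟩, fun i s hs => ?_⟩
  · rw [hτ _ _ (Or.inr rfl), Fin.cons_zero, if_neg one_ne_zero]
  · rw [hτ _ _ (Or.inl rfl), Fin.cons_zero, if_pos rfl]
  · rw [hτ _ _ hs, Fin.cons_succ]

/-- The augmentation. -/
def aug (F : Type*) [Field F] (S : Type*) : (S →₀ F) →ₗ[F] F :=
  Finsupp.linearCombination F fun _ => 1

theorem aug_shift_pow {G ι S : Type*} [Fintype ι] [Monoid G] [MulAction G S] (a : ι → F)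
    (γ : ι → G) {e : ℕ} (he : 0 < e) (x : S →₀ F) : aug F S ((shift a γ S ^ e) x) = 0 := by
  obtain ⟨e, rfl⟩ := Nat.exists_eq_add_of_le' he
  have h : ∀ g : G, aug F S ∘ₗ translate F S g = aug F S := by
    intro g
    ext s
    simp [aug, translate_single]
  have h' : ∀ (g : G) y, aug F S (translate F S g y) = aug F S y :=
    fun (g : G) y => LinearMap.congr_fun (h g) y
  rw [pow_succ', Module.End.mul_apply, shift]
  simp [h', LinearMap.sum_apply]

theorem cubeBd_cone_zero [PathConnectedSpace X] (x₀ : X) (x : C(Fin 0 → I, X) →₀ F) :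
    cubeBd F X 0 (Finsupp.lmapDomain F F (cone x₀ 0) x) =
      x - aug F _ x • Finsupp.single (.const _ x₀) 1 := by
  have : cubeBd F X 0 ∘ₗ Finsupp.lmapDomain F F (cone x₀ 0) =
      LinearMap.id - (aug F _).smulRight (Finsupp.single (.const _ x₀) 1) := by
    ext q : 2
    simp [cubeBd_apply, face_zero_cone_zero, aug]
  exact LinearMap.congr_fun this x

theorem cubeBd_cone_succ [PathConnectedSpace X] (x₀ : X) (hX : HasFillings n X) (hm : m + 1 ≤ n)
    (x : C(Fin (m + 1) → I, X) →₀ F) :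
    cubeBd F X (m + 1) (Finsupp.lmapDomain F F (cone x₀ (m + 1)) x) =
      x - aug F _ x • Finsupp.single (.const _ x₀) 1 -
        Finsupp.lmapDomain F F (cone x₀ m) (cubeBd F X m x) := by
  have : cubeBd F X (m + 1) ∘ₗ Finsupp.lmapDomain F F (cone x₀ (m + 1)) =
      LinearMap.id - (aug F _).smulRight (Finsupp.single (.const _ x₀) 1) -
        Finsupp.lmapDomain F F (cone x₀ m) ∘ₗ cubeBd F X m := by
    ext q : 2
    have h := face_cone_succ x₀ hX m hm q
    have h' := fun i => h.2 i 0 (Or.inl rfl)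
    have hm₀ : ∀ (τ : C(Fin m → I, X)) (r : F), Finsupp.lmapDomain F F (cone x₀ m)
        (Finsupp.single τ r) = Finsupp.single (cone x₀ m τ) r := fun τ r => by simp
    have hm₁ : Finsupp.lmapDomain F F (cone x₀ (m + 1))
        (Finsupp.single q 1) = Finsupp.single (cone x₀ (m + 1) q) 1 := by simp
    have h'' := fun i => h.2 i 1 (Or.inr rfl)
    simp only [LinearMap.comp_apply, Finsupp.lsingle_apply, cubeBd_apply,
      Fin.sum_univ_succ (n := m + 1),
      hm₀, hm₁, faceL_single, h.1, h', h'', map_sum, map_smul,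
      map_add, map_neg, LinearMap.sub_apply, LinearMap.id_apply, LinearMap.smulRight_apply, aug,
      Finsupp.linearCombination_single, Fin.val_zero, pow_zero, one_smul, Fin.val_succ, pow_succ,
      mul_neg_one, neg_smul, Finset.sum_neg_distrib, sub_eq_add_neg]
  exact LinearMap.congr_fun this x

end Cones

section TowerOfFillings

variable {F : Type*} [Field F] {p k : ℕ} [Fact p.Prime] [Algebra (ZMod p) F]
  {X : Type*} [TopologicalSpace X] [MulAction (Multiplicative (Fin k → ZMod p)) X]
  [ContinuousConstSMul (Multiplicative (Fin k → ZMod p)) X]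

/-- The iterated cones forming a resolution. -/
def coneTower (a : Fin k → F) (x₀ : X) : (i : ℕ) → (C(Fin i → I, X) →₀ F)
  | 0 => Finsupp.single (.const _ x₀) 1
  | i + 1 => Finsupp.lmapDomain F F (cone x₀ i)
      ((shift a (gen p k) _ ^ expo p i) (coneTower a x₀ i))

theorem HasFillings.hasTower [PathConnectedSpace X] {n : ℕ} (hX : HasFillings n X)
    (a : Fin k → F) : HasTower (p := p) a (n + 1) X := by
  obtain ⟨x₀⟩ : Nonempty X := inferInstance
  refine hasTower_of_cubes a (n + 1) (.const _ x₀) (coneTower (p := p) a x₀) rfl fun i hi => ?_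
  have haug : ∀ i, aug F _ ((shift a (gen p k) _ ^ expo p i) (coneTower (p := p) a x₀ i)) = 0 :=
    fun i => aug_shift_pow a _ (expo_pos i) _
  induction i with
  | zero =>
    rw [coneTower.eq_2, cubeBd_cone_zero, haug, zero_smul, sub_zero]
  | succ i ih =>
    rw [coneTower.eq_2 _ _ (i + 1), cubeBd_cone_succ x₀ hX (by omega), haug, zero_smul, sub_zero,
      shift_pow_comm_of_equivariant a _ (cubeBd F X i) cubeBd_single_smul, ih (by omega),
      shift_pow_expo_succ_shift_pow_expo, map_zero, sub_zero]

end TowerOfFillings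

/-! ### Collapsing the boundary of a cube -/

section Collapse

variable {m : ℕ}

/-- A map of a cube, in coordinates ranging over `[-1, 1]`, to the nonzero vectors that collapses
the boundary to a point and that is injective up to scaling otherwise. -/
def wrap (w : Fin m → ℝ) : Fin (m + 1) → ℝ :=
  Fin.cons (1 - 2 * ‖w‖) ((1 - ‖w‖) • w)

theorem continuous_wrap : Continuous (wrap (m := m)) := by
  unfold wrap
  fun_prop

theorem wrap_zero_eq (w : Fin m → ℝ) : wrap w 0 = 1 - 2 * ‖w‖ := rfl

theorem tail_wrap (w : Fin m → ℝ) : Fin.tail (wrap w) = (1 - ‖w‖) • w := by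
  simp [wrap]

theorem wrap_of_norm_eq_one {w : Fin m → ℝ} (hw : ‖w‖ = 1) : wrap w = Fin.cons (-1) 0 := by
  rw [wrap, hw]
  norm_num

theorem wrap_ne_zero (w : Fin m → ℝ) : wrap w ≠ 0 := by
  intro h
  have h0 := congrFun h 0
  rw [wrap_zero_eq, Pi.zero_apply] at h0
  have h1 : Fin.tail (wrap w) = 0 := by rw [h]; rfl
  rw [tail_wrap, smul_eq_zero] at h1
  rcases h1 with h1 | h1
  · linarith
  · rw [h1, norm_zero] at h0
    norm_num at h0

theorem wrap_injective_of_smul {w w' : Fin m → ℝ} (hw : ‖w‖ ≤ 1) (hw' : ‖w'‖ ≤ 1) {c : ℝ}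
    (hc : 0 < c) (h : wrap w = c • wrap w') : w = w' ∨ (‖w‖ = 1 ∧ ‖w'‖ = 1) := by
  have h0 : 1 - 2 * ‖w‖ = c * (1 - 2 * ‖w'‖) := congrFun h 0
  have h1 : (1 - ‖w‖) • w = (c * (1 - ‖w'‖)) • w' := by
    have := congrArg Fin.tail h
    rw [tail_wrap] at this
    rw [this, mul_smul, ← tail_wrap]
    rfl
  have h2 : (1 - ‖w‖) * ‖w‖ = c * (1 - ‖w'‖) * ‖w'‖ := by
    have := congrArg norm h1
    rwa [norm_smul, norm_smul, Real.norm_of_nonneg (by linarith),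
      Real.norm_of_nonneg (mul_nonneg hc.le (by linarith))] at this
  have hr := norm_nonneg w
  have hr' := norm_nonneg w'
  generalize ‖w‖ = r at *
  generalize ‖w'‖ = r' at *
  have h3 : c * ((r' - r) * ((1 - r) * (1 - r') + r * r')) = 0 := by
    linear_combination (1 - r) * r * h0 - (1 - 2 * r) * h2
  rcases mul_eq_zero.1 h3 with h3 | h3
  · exact absurd h3 hc.ne'
  rcases mul_eq_zero.1 h3 with h3 | h3
  · obtain rfl : r = r' := by linarith
    rcases eq_or_lt_of_le hw with h4 | h4
    · exact Or.inr ⟨h4, h4⟩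
    · have hc1 : c = 1 := by
        by_cases h5 : r = 0
        · rw [h5] at h0
          linarith
        · have h6 : (1 - r) * r ≠ 0 := mul_ne_zero (by linarith) h5
          apply mul_right_cancel₀ h6
          linarith
      rw [hc1, one_mul] at h1
      exact Or.inl (smul_right_injective _ (by linarith : (1 - r) ≠ 0) h1)
  · exfalso
    have h5 : 0 ≤ (1 - r) * (1 - r') := mul_nonneg (by linarith) (by linarith)
    have h6 : 0 ≤ r * r' := mul_nonneg hr hr'
    have h7 : (1 - r) * (1 - r') = 0 := by linarith
    have h8 : r * r' = 0 := by linarith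
    rcases mul_eq_zero.1 h7 with h7 | h7 <;> rcases mul_eq_zero.1 h8 with h8 | h8 <;>
      nlinarith

theorem exists_wrap_eq_smul {z : Fin (m + 1 + 1) → ℝ} (hz : z ≠ 0) :
    ∃ w : Fin (m + 1) → ℝ, ‖w‖ ≤ 1 ∧ ∃ c : ℝ, 0 < c ∧ wrap w = c • z := by
  obtain ⟨a, b, rfl⟩ : ∃ (a : ℝ) (b : Fin (m + 1) → ℝ), z = Fin.cons a b :=
    ⟨z 0, Fin.tail z, (Fin.cons_self_tail z).symm⟩
  have hsmul : ∀ c : ℝ, c • (Fin.cons a b : Fin (m + 1 + 1) → ℝ) = Fin.cons (c * a) (c • b) := by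
    intro c
    ext i
    refine Fin.cases ?_ (fun i => ?_) i <;> simp
  by_cases hb : b = 0
  · subst hb
    have ha : a ≠ 0 := by
      rintro rfl
      exact hz (by ext i; refine Fin.cases ?_ (fun i => ?_) i <;> simp)
    rcases lt_or_gt_of_ne ha with ha | ha
    · have hn : ‖(fun _ => 1 : Fin (m + 1) → ℝ)‖ = 1 := by simp
      refine ⟨fun _ => 1, hn.le, -a⁻¹, by simpa using ha, ?_⟩
      rw [wrap_of_norm_eq_one hn, hsmul, smul_zero]
      congr 1
      field_simp
    · refine ⟨0, by simp, a⁻¹, by simpa using ha, ?_⟩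
      rw [wrap, hsmul, smul_zero, smul_zero, inv_mul_cancel₀ ha.ne']
      simp
  · have hb' : 0 < ‖b‖ := norm_pos_iff.2 hb
    have hiv := intermediate_value_Icc' (f := fun r : ℝ => (1 - 2 * r) * ‖b‖ - a * (r * (1 - r)))
      zero_le_one (by fun_prop)
    obtain ⟨r, hr, hr0⟩ := hiv (show (0 : ℝ) ∈ _ by constructor <;> norm_num)
    have hr1 : r ≠ 0 := by
      rintro rfl
      norm_num at hr0
      exact hb hr0
    have hr2 : r ≠ 1 := by
      rintro rfl
      norm_num at hr0
      exact hb hr0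
    have hn : ‖(r / ‖b‖) • b‖ = r := by
      rw [norm_smul, Real.norm_of_nonneg (div_nonneg hr.1 hb'.le), div_mul_cancel₀ _ hb'.ne']
    have h1 : 0 < r := lt_of_le_of_ne hr.1 hr1.symm
    have h2 : 0 < 1 - r := sub_pos.2 (lt_of_le_of_ne hr.2 hr2)
    refine ⟨(r / ‖b‖) • b, hn.trans_le hr.2, (1 - r) * (r / ‖b‖), by positivity, ?_⟩
    rw [wrap, hn, hsmul, smul_smul]
    congr 1
    field_simp
    linarith

/-- The coordinates of a point of a cube, rescaled to `[-1, 1]`. -/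
def cubeCoord (u : Fin m → I) : Fin m → ℝ := fun i => 2 * u i - 1

/-- The point of a cube with given rescaled coordinates. -/
def ofCubeCoord (z : Fin m → ℝ) : Fin m → I :=
  fun i => Set.projIcc 0 1 zero_le_one ((1 + z i) / 2)

theorem continuous_cubeCoord : Continuous (cubeCoord (m := m)) := by
  unfold cubeCoord
  fun_prop

theorem continuous_ofCubeCoord : Continuous (ofCubeCoord (m := m)) := by
  unfold ofCubeCoord
  exact continuous_pi fun i => continuous_projIcc.comp (by fun_prop)

theorem norm_cubeCoord_le (u : Fin m → I) : ‖cubeCoord u‖ ≤ 1 := by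
  refine (pi_norm_le_iff_of_nonneg zero_le_one).2 fun i => ?_
  rw [Real.norm_eq_abs, abs_le, cubeCoord]
  constructor <;> linarith [(u i).2.1, (u i).2.2]

theorem ofCubeCoord_cubeCoord (u : Fin m → I) : ofCubeCoord (cubeCoord u) = u := by
  ext i
  rw [ofCubeCoord, cubeCoord, add_sub_cancel, mul_div_cancel_left₀ _ two_ne_zero,
    Set.projIcc_val]

theorem cubeCoord_ofCubeCoord {z : Fin m → ℝ} (hz : ‖z‖ ≤ 1) : cubeCoord (ofCubeCoord z) = z := by
  ext i
  have := abs_le.1 ((norm_le_pi_norm z i).trans hz)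
  rw [cubeCoord, ofCubeCoord, Set.projIcc_of_mem _ ⟨by linarith, by linarith⟩]
  simp only
  ring

theorem norm_cubeCoord_eq_one_iff (u : Fin (m + 1) → I) :
    ‖cubeCoord u‖ = 1 ↔ u ∈ Cube.boundary (Fin (m + 1)) := by
  have h : ∀ i, ‖cubeCoord u i‖ = 1 ↔ u i = 0 ∨ u i = 1 := by
    intro i
    rw [Real.norm_eq_abs, abs_eq zero_le_one, cubeCoord, or_comm, Subtype.ext_iff, Subtype.ext_iff,
      Set.Icc.coe_zero, Set.Icc.coe_one]
    refine or_congr ?_ ?_ <;> constructor <;> intro h <;> linarith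
  constructor
  · intro h1
    obtain ⟨i, hi⟩ := exists_norm_apply_eq (cubeCoord u)
    exact ⟨i, (h i).1 (hi.trans h1)⟩
  · rintro ⟨i, hi⟩
    exact le_antisymm (norm_cubeCoord_le u) (((h i).2 hi).symm.trans_le (norm_le_pi_norm _ i))

/-- The map of a cube onto the boundary of a cube of one more dimension which collapses the
boundary. -/
def collapse (u : Fin m → I) : Fin (m + 1) → ℝ := ‖wrap (cubeCoord u)‖⁻¹ • wrap (cubeCoord u)

theorem norm_wrap_ne_zero (w : Fin m → ℝ) : ‖wrap w‖ ≠ 0 := norm_ne_zero_iff.2 (wrap_ne_zero w)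

theorem continuous_collapse : Continuous (collapse (m := m)) := by
  have h := continuous_wrap.comp (continuous_cubeCoord (m := m))
  exact (h.norm.inv₀ fun u => norm_wrap_ne_zero _).smul h

theorem norm_collapse (u : Fin m → I) : ‖collapse u‖ = 1 := by
  rw [collapse, norm_smul, norm_inv, norm_norm, inv_mul_cancel₀ (norm_wrap_ne_zero _)]

theorem collapse_eq_of_mem_boundary {u v : Fin (m + 1) → I} (hu : u ∈ Cube.boundary (Fin (m + 1)))
    (hv : v ∈ Cube.boundary (Fin (m + 1))) : collapse u = collapse v := by
  rw [← norm_cubeCoord_eq_one_iff] at hu hv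
  rw [collapse, collapse, wrap_of_norm_eq_one hu, wrap_of_norm_eq_one hv]

theorem eq_or_mem_boundary_of_collapse_eq {u v : Fin (m + 1) → I} (h : collapse u = collapse v) :
    u = v ∨ (u ∈ Cube.boundary (Fin (m + 1)) ∧ v ∈ Cube.boundary (Fin (m + 1))) := by
  rw [← norm_cubeCoord_eq_one_iff, ← norm_cubeCoord_eq_one_iff]
  have hu := (norm_wrap_ne_zero (cubeCoord u)).symm.lt_of_le (norm_nonneg _)
  have hv := (norm_wrap_ne_zero (cubeCoord v)).symm.lt_of_le (norm_nonneg _)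
  refine (wrap_injective_of_smul (norm_cubeCoord_le u) (norm_cubeCoord_le v)
    (c := ‖wrap (cubeCoord u)‖ * ‖wrap (cubeCoord v)‖⁻¹) (by positivity) ?_).imp_left fun h => ?_
  · rw [mul_smul]
    change _ = _ • collapse v
    rw [← h, collapse, smul_inv_smul₀ hu.ne']
  · rw [← ofCubeCoord_cubeCoord u, h, ofCubeCoord_cubeCoord]

theorem exists_collapse_eq {z : Fin (m + 1 + 1) → ℝ} (hz : ‖z‖ = 1) :
    ∃ u : Fin (m + 1) → I, collapse u = z := by
  obtain ⟨w, hw, c, hc, h⟩ := exists_wrap_eq_smul (z := z) (by rintro rfl; simp at hz)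
  refine ⟨ofCubeCoord w, ?_⟩
  rw [collapse, cubeCoord_ofCubeCoord hw, h, norm_smul, hz, mul_one, Real.norm_of_nonneg hc.le,
    inv_smul_smul₀ hc.ne']

end Collapse

/-! ### Filling boundaries of cubes -/

section Filling

variable {X : Type*} [TopologicalSpace X] {m n : ℕ}

theorem exists_extend_of_continuousOn_boundary
    (hX : ∀ x : X, Subsingleton (HomotopyGroup (Fin (m + 1)) X x)) (g : (Fin (m + 1 + 1) → I) → X)
    (hg : ContinuousOn g (Cube.boundary (Fin (m + 1 + 1)))) :
    ∃ τ : C(Fin (m + 1 + 1) → I, X), ∀ y ∈ Cube.boundary (Fin (m + 1 + 1)), τ y = g y := by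
  have hb : ∀ u : Fin (m + 1) → I,
      ofCubeCoord (collapse u) ∈ Cube.boundary (Fin (m + 1 + 1)) := fun u => by
    rw [← norm_cubeCoord_eq_one_iff, cubeCoord_ofCubeCoord (norm_collapse u).le, norm_collapse]
  have h0 : (0 : Fin (m + 1) → I) ∈ Cube.boundary (Fin (m + 1)) := ⟨0, Or.inl rfl⟩
  let x₀ : X := g (ofCubeCoord (collapse (0 : Fin (m + 1) → I)))
  let f : GenLoop (Fin (m + 1)) X x₀ :=
    ⟨⟨fun u => g (ofCubeCoord (collapse u)), hg.comp_continuous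
      (continuous_ofCubeCoord.comp continuous_collapse) hb⟩, fun u hu => by
        change g _ = g _
        rw [collapse_eq_of_mem_boundary hu h0]⟩
  have := hX x₀
  have hf : GenLoop.Homotopic f GenLoop.const :=
    Quotient.exact (s := GenLoop.Homotopic.setoid (Fin (m + 1)) x₀) (Subsingleton.elim
      (α := HomotopyGroup (Fin (m + 1)) X x₀) _ _)
  obtain ⟨H⟩ := hf
  let Q : C(I × (Fin (m + 1) → I), Fin (m + 1 + 1) → I) :=
    ⟨fun a => ofCubeCoord ((1 - (a.1 : ℝ)) • collapse a.2),
      continuous_ofCubeCoord.comp (((continuous_const.sub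
        (continuous_subtype_val.comp continuous_fst))).smul
          (continuous_collapse.comp continuous_snd))⟩
  have hnorm : ∀ a : I × (Fin (m + 1) → I), ‖(1 - (a.1 : ℝ)) • collapse a.2‖ = 1 - a.1 := by
    intro a
    rw [norm_smul, norm_collapse, mul_one, Real.norm_of_nonneg (sub_nonneg.2 a.1.2.2)]
  have hle : ∀ a : I × (Fin (m + 1) → I), ‖(1 - (a.1 : ℝ)) • collapse a.2‖ ≤ 1 := fun a => by
    rw [hnorm]
    linarith [a.1.2.1]
  have hQs : Function.Surjective Q := by
    intro y
    by_cases hy : cubeCoord y = 0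
    · refine ⟨(1, 0), ?_⟩
      rw [← ofCubeCoord_cubeCoord y, hy]
      simp [Q]
    · have hy' : ‖cubeCoord y‖ ≠ 0 := norm_ne_zero_iff.2 hy
      obtain ⟨u, hu⟩ := exists_collapse_eq (z := ‖cubeCoord y‖⁻¹ • cubeCoord y) (by
        rw [norm_smul, norm_inv, norm_norm, inv_mul_cancel₀ hy'])
      refine ⟨(⟨1 - ‖cubeCoord y‖, by linarith [norm_cubeCoord_le y],
        by linarith [norm_nonneg (cubeCoord y)]⟩, u), ?_⟩
      simp only [Q, ContinuousMap.coe_mk]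
      rw [hu, sub_sub_cancel, smul_inv_smul₀ hy', ofCubeCoord_cubeCoord]
  have hQ : Topology.IsQuotientMap Q := .of_surjective_continuous hQs Q.continuous
  have hfac : Function.FactorsThrough H Q := by
    rintro ⟨s, u⟩ ⟨t, v⟩ h
    have h1 := congrArg cubeCoord h
    simp only [Q, ContinuousMap.coe_mk] at h1
    rw [cubeCoord_ofCubeCoord (hle (s, u)), cubeCoord_ofCubeCoord (hle (t, v))] at h1
    have h2 := congrArg norm h1
    rw [hnorm (s, u), hnorm (t, v)] at h2
    obtain rfl : s = t := Subtype.ext (by simpa using h2)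
    by_cases hs : s = 1
    · rw [hs]
      exact (H.apply_one u).trans (H.apply_one v).symm
    · have hs' : (1 - (s : ℝ)) ≠ 0 := by
        rw [sub_ne_zero]
        exact fun h => hs (Subtype.ext h.symm)
      rcases eq_or_mem_boundary_of_collapse_eq (smul_right_injective _ hs' h1) with rfl | ⟨hu, hv⟩
      · rfl
      · rw [H.eq_fst s hu, H.eq_fst s hv]
        exact (f.2 u hu).trans (f.2 v hv).symm
  refine ⟨hQ.lift (H : C(I × (Fin (m + 1) → I), X)) hfac, fun y hy => ?_⟩
  rw [← norm_cubeCoord_eq_one_iff] at hy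
  obtain ⟨u, hu⟩ := exists_collapse_eq hy
  have hQy : Q (0, u) = y := by
    simp [Q, hu, ofCubeCoord_cubeCoord]
  rw [← hQy]
  refine (ContinuousMap.congr_fun (hQ.lift_comp (H : C(I × (Fin (m + 1) → I), X)) hfac)
    (0, u)).trans ((H.apply_zero u).trans ?_)
  rw [hQy, ← ofCubeCoord_cubeCoord y, ← hu]
  rfl

theorem eq_of_insertNth_eq_insertNth {α : Type*} {i j : Fin (m + 1)} (h : i ≤ j) {s t : α}
    {u v : Fin (m + 1) → α}
    (huv : i.castSucc.insertNth (α := fun _ => α) s u = j.succ.insertNth (α := fun _ => α) t v) :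
    ∃ w, u = j.insertNth (α := fun _ => α) t w ∧ v = i.insertNth (α := fun _ => α) s w := by
  have h1 : i.castSucc.succAbove j = j.succ :=
    Fin.succAbove_of_le_castSucc _ _ (Fin.castSucc_le_castSucc_iff.2 h)
  have hu : u j = t := by
    have := congrFun huv j.succ
    rw [Fin.insertNth_apply_same, ← h1, Fin.insertNth_apply_succAbove] at this
    exact this
  have hu' : u = j.insertNth (α := fun _ => α) t (j.removeNth u) := by
    rw [← hu, Fin.insertNth_self_removeNth]
  refine ⟨j.removeNth u, hu', ?_⟩
  have h2 := congrArg (Fin.removeNth j.succ) huv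
  rw [Fin.removeNth_insertNth, hu', ← insertNth_succ_insertNth h, Fin.removeNth_insertNth] at h2
  exact h2.symm

theorem hasFillings_of_homotopyGroup
    (hX : ∀ m : ℕ, 1 ≤ m → m ≤ n → ∀ x : X, Subsingleton (HomotopyGroup (Fin m) X x)) :
    HasFillings n X := by
  intro m hm φ hφ
  have hlt : ∀ (i j : Fin (m + 1 + 1)) (s t : I) (u v : Fin (m + 1) → I), s = 0 ∨ s = 1 →
      t = 0 ∨ t = 1 → i < j → i.insertNth (α := fun _ => I) s u =
        j.insertNth (α := fun _ => I) t v → φ i s u = φ j t v := by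
    intro i j s t u v hs ht hij h
    obtain ⟨i, rfl⟩ := Fin.exists_castSucc_eq.2 (hij.trans_le (Fin.le_last j)).ne
    obtain ⟨j, rfl⟩ := Fin.exists_succ_eq.2 ((Fin.zero_le _).trans_lt hij).ne'
    have hij' := Fin.castSucc_lt_succ_iff.1 hij
    obtain ⟨w, rfl, rfl⟩ := eq_of_insertNth_eq_insertNth hij' h
    exact (ContinuousMap.congr_fun (hφ i j hij' s t hs ht) w).symm
  have hall : ∀ (i j : Fin (m + 1 + 1)) (s t : I) (u v : Fin (m + 1) → I), s = 0 ∨ s = 1 →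
      t = 0 ∨ t = 1 → i.insertNth (α := fun _ => I) s u =
        j.insertNth (α := fun _ => I) t v → φ i s u = φ j t v := by
    intro i j s t u v hs ht h
    rcases lt_trichotomy i j with hij | rfl | hij
    · exact hlt i j s t u v hs ht hij h
    · obtain ⟨rfl, rfl⟩ := Fin.insertNth_inj.1 h
      rfl
    · exact (hlt j i t s v u ht hs hij h.symm).symm
  classical
  let g : (Fin (m + 1 + 1) → I) → X := fun y =>
    if h : ∃ i, y i = 0 ∨ y i = 1 then φ h.choose (y h.choose) (h.choose.removeNth y)
    else φ 0 0 0
  have hg : ∀ i s u, s = 0 ∨ s = 1 → g (i.insertNth (α := fun _ => I) s u) = φ i s u := by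
    intro i s u hs
    have h : ∃ j, i.insertNth (α := fun _ => I) s u j = 0 ∨
        i.insertNth (α := fun _ => I) s u j = 1 := ⟨i, by rwa [Fin.insertNth_apply_same]⟩
    simp only [g]
    rw [dif_pos h]
    exact hall _ _ _ _ _ _ h.choose_spec hs (Fin.insertNth_self_removeNth _ _)
  have hgc : ContinuousOn g (Cube.boundary (Fin (m + 1 + 1))) := by
    have hU : Cube.boundary (Fin (m + 1 + 1)) =
        ⋃ a : Fin (m + 1 + 1) × Bool, {y | y a.1 = if a.2 then 1 else 0} := by
      ext y
      simp [Cube.boundary]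
    rw [hU]
    refine (locallyFinite_of_finite _).continuousOn_iUnion
      (fun a => isClosed_eq (continuous_apply _) continuous_const) fun a => ?_
    have hc : ContinuousOn (fun y : Fin (m + 1 + 1) → I =>
        φ a.1 (if a.2 then 1 else 0) (fun l => y (a.1.succAbove l)))
        {y | y a.1 = if a.2 then 1 else 0} :=
      ((φ a.1 _).continuous.comp (by fun_prop)).continuousOn
    refine hc.congr fun y hy => ?_
    have hy' : y a.1 = if a.2 then 1 else 0 := hy
    have hy'' : y = a.1.insertNth (α := fun _ => I) (if a.2 then 1 else 0)
        (fun l => y (a.1.succAbove l)) := by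
      rw [← hy']
      exact (Fin.insertNth_self_removeNth a.1 y).symm
    conv_lhs => rw [hy'']
    exact hg _ _ _ (by cases a.2 <;> simp)
  obtain ⟨τ, hτ⟩ := exists_extend_of_continuousOn_boundary (hX (m + 1) (by omega) hm) g hgc
  refine ⟨τ, fun i s hs => ?_⟩
  ext u
  rw [face_apply, hτ _ ⟨i, by rwa [Fin.insertNth_apply_same]⟩, hg i s u hs]

end Filling

/-! ### Pushing forward towers -/

section Push

variable {F : Type*} [Field F] {p k : ℕ} [Fact p.Prime]
  {X Y : Type*} [TopologicalSpace X] [TopologicalSpace Y]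
  [MulAction (Multiplicative (Fin k → ZMod p)) X] [MulAction (Multiplicative (Fin k → ZMod p)) Y]

theorem HasTower.map {a : Fin k → F} {j : ℕ} (h : HasTower (p := p) a j X) {f : X → Y}
    (hf : Continuous f)
    (hfe : ∀ (g : Multiplicative (Fin k → ZMod p)) (x : X), f (g • x) = g • f x) :
    HasTower (p := p) a j Y := by
  intro 𝒱 hVo hVc
  obtain ⟨w, hw1, hw2, hw3⟩ := h ((f ⁻¹' ·) '' 𝒱)
    (by rintro _ ⟨V, hV, rfl⟩; exact (hVo V hV).preimage hf)
    (by rw [Set.sUnion_image, ← Set.preimage_iUnion₂, ← Set.sUnion_eq_biUnion, hVc,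
      Set.preimage_univ])
  have himg : ∀ (g : Multiplicative (Fin k → ZMod p)) (A : Set X), f '' (g • A) = g • f '' A := by
    intro g A
    rw [← Set.image_smul, ← Set.image_smul, Set.image_image, Set.image_image]
    simp only [hfe]
  refine ⟨fun i => mapL F (f '' ·) (w i), fun i hi => ?_, ?_, fun i hi => ?_⟩
  · refine map_mem_supported _ (fun l hl => ?_) (hw1 i hi)
    obtain ⟨h1, h2, h3⟩ := hl
    rw [mapL_single]
    refine Finsupp.single_mem_supported F _ ⟨by simpa using h1, ?_, ?_⟩
    · rw [List.pairwise_map]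
      exact h2.imp fun hab => Set.image_mono hab
    · simp only [List.mem_map, forall_exists_index, and_imp, forall_apply_eq_imp_iff₂]
      refine fun A hA => ⟨(h3 A hA).1.image f, fun g => ?_⟩
      obtain ⟨_, ⟨V, hV, rfl⟩, hgV⟩ := (h3 A hA).2 g
      exact ⟨V, hV, by rw [← himg]; exact Set.image_subset_iff.2 hgV⟩
  · rw [bd_mapL, hw2, mapL_single, List.map_nil]
  · rw [bd_mapL, ← nondeg_mapL_nondeg, hw3 i hi, nondeg_mapL_nondeg,
      shift_pow_mapL a _ _ himg]

end Push

end Volovikov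

/-- **Borsuk–Ulam type theorem of Volovikov.** Let `p` be a prime, and let
`G = (ℤ/p)^k` be the elementary abelian group of order `p^k`. If `X` is an
`n`-connected space with a continuous fixed-point free `G`-action and `Y` is
homeomorphic to the `n`-sphere and carries a continuous fixed-point free
`G`-action, then there is no continuous `G`-equivariant map `f : X → Y`. -/
theorem volovikov_borsuk_ulam (p k n : ℕ) (hp : p.Prime) (hk : 0 < k)
    (X : Type) [TopologicalSpace X]
    (Y : Type) [TopologicalSpace Y]
    [MulAction (Multiplicative (Fin k → ZMod p)) X]
    [MulAction (Multiplicative (Fin k → ZMod p)) Y]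
    (hXcont : ∀ g : Multiplicative (Fin k → ZMod p), Continuous fun x : X => g • x)
    (hYcont : ∀ g : Multiplicative (Fin k → ZMod p), Continuous fun y : Y => g • y)
    (hXfree : ¬ ∃ x : X, ∀ g : Multiplicative (Fin k → ZMod p), g • x = x)
    (hYfree : ¬ ∃ y : Y, ∀ g : Multiplicative (Fin k → ZMod p), g • y = y)
    (hXnonempty : Nonempty X) (hXpath : PathConnectedSpace X)
    (hXconn : ∀ m : ℕ, 1 ≤ m → m ≤ n → ∀ x : X,
      Subsingleton (HomotopyGroup (Fin m) X x))
    (hY : Nonempty (Y ≃ₜ (Metric.sphere (0 : EuclideanSpace ℝ (Fin (n + 1))) 1 :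
      Set (EuclideanSpace ℝ (Fin (n + 1)))))) :
    ¬ ∃ f : X → Y, Continuous f ∧
      ∀ (g : Multiplicative (Fin k → ZMod p)) (x : X), f (g • x) = g • f x := by
  rintro ⟨f, hf, hfe⟩
  have : Fact p.Prime := ⟨hp⟩
  have : ContinuousConstSMul (Multiplicative (Fin k → ZMod p)) X := ⟨hXcont⟩
  obtain ⟨h⟩ := hY
  have : CompactSpace Y := h.symm.compactSpace
  have : T2Space Y := h.symm.t2Space
  let b := Module.finBasisOfFinrankEq (ZMod p) (GaloisField p k) (GaloisField.finrank p hk.ne')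
  obtain ⟨M, hM⟩ := Volovikov.exists_forall_not_hasTower b.linearIndependent hYcont hYfree
  exact hM (max (n + 1) (M + 1)) (by omega)
    (Volovikov.HasTower.of_le (Volovikov.hasRankedRefinements_of_homeomorph_sphere h) hYcont
      (((Volovikov.hasFillings_of_homotopyGroup hXconn).hasTower b).map hf hfe) _
      (le_max_left _ _))
end
end

section
/- Comparison of illumination complexes: Let Δ = conv{a_0,…,a_d} ⊂ ℝ^d be a non-degenerate simplex with barycenter at the origin, let R_Δ be the associated Δ-zonotope, and let S be a finite non-empty set. Then the illumination complex A(R_Δ, F_Δ, S) and the modified illumination complex B(Δ, S) are homeomorphic, and the homeomorphism can be chosen equivariantly with respect to every permutation π of S (acting on both spaces by (x,f) ↦ (x, π∘f)). -/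
noncomputable section

/-- The cone over the facet `F i = conv {a j | j ≠ i}` of the simplex with vertex
set `a`, with apex at the origin: `cone(F i) = {∑_{j ≠ i} t j • a j : t j ≥ 0}`. -/
def coneFace {d : ℕ} (a : Fin (d + 1) → EuclideanSpace ℝ (Fin d)) (i : Fin (d + 1)) :
    Set (EuclideanSpace ℝ (Fin d)) :=
  {z | ∃ t : Fin (d + 1) → ℝ, (∀ k, 0 ≤ t k) ∧ t i = 0 ∧ z = ∑ k, t k • a k}

/-- The Δ-zonotope `R_Δ = [0, a 0] + [0, a 1] + ⋯ + [0, a d]`, the Minkowski sum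
of the segments `[0, a i] = {t • a i : 0 ≤ t ≤ 1}`. -/
def zonotope {d : ℕ} (a : Fin (d + 1) → EuclideanSpace ℝ (Fin d)) :
    Set (EuclideanSpace ℝ (Fin d)) :=
  {z | ∃ t : Fin (d + 1) → ℝ, (∀ k, t k ∈ Set.Icc (0 : ℝ) 1) ∧ z = ∑ k, t k • a k}

/-- The facet `F i = conv {a j : j ≠ i}` of the simplex with vertex set `a`,
opposite the vertex `a i`. -/
def facet {d : ℕ} (a : Fin (d + 1) → EuclideanSpace ℝ (Fin d)) (i : Fin (d + 1)) :
    Set (EuclideanSpace ℝ (Fin d)) :=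
  convexHull ℝ (a '' {j | j ≠ i})

/-- The identification generating the illumination complex `A(R_Δ, F_Δ, S)`:
`(x, f) ∼ (x, g)` iff `f i = g i` for every `i` such that
`int (x + cone (F i)) ∩ int (R_Δ) ≠ ∅`. -/
def ARel {d : ℕ} (a : Fin (d + 1) → EuclideanSpace ℝ (Fin d)) (S : Type*)
    (p q : ↥(zonotope a) × (Fin (d + 1) → S)) : Prop :=
  p.1 = q.1 ∧ ∀ i : Fin (d + 1),
    (interior (((p.1 : EuclideanSpace ℝ (Fin d)) + ·) '' coneFace a i) ∩
        interior (zonotope a)).Nonempty →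
    p.2 i = q.2 i

/-- The illumination complex `A(R_Δ, F_Δ, S) = (R_Δ × Fun({0,…,d}, S)) / ∼`,
with the quotient topology. -/
abbrev AComplex {d : ℕ} (a : Fin (d + 1) → EuclideanSpace ℝ (Fin d)) (S : Type*) :=
  Quot (ARel a S)

/-- The identification generating the modified illumination complex `B(Δ, S)`:
`(x, f) ∼ (x, g)` iff `f i = g i` for every `i` with `x ∉ F i`. -/
def BRel {d : ℕ} (a : Fin (d + 1) → EuclideanSpace ℝ (Fin d)) (S : Type*)
    (p q : ↥(convexHull ℝ (Set.range a)) × (Fin (d + 1) → S)) : Prop :=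
  p.1 = q.1 ∧ ∀ i : Fin (d + 1), (p.1 : EuclideanSpace ℝ (Fin d)) ∉ facet a i →
    p.2 i = q.2 i

/-- The modified illumination complex `B(Δ, S) = (Δ × Fun({0,…,d}, S)) / ∼`,
with the quotient topology. -/
abbrev BComplex {d : ℕ} (a : Fin (d + 1) → EuclideanSpace ℝ (Fin d)) (S : Type*) :=
  Quot (BRel a S)

/-- The action of a permutation `π` of the colors on the illumination complex
`A(R_Δ, F_Δ, S)`, induced by `(x, f) ↦ (x, π ∘ f)`. -/
def permActA {d : ℕ} (a : Fin (d + 1) → EuclideanSpace ℝ (Fin d)) {S : Type*}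
    (π : Equiv.Perm S) : AComplex a S → AComplex a S :=
  Quot.map (fun p => (p.1, π ∘ p.2))
    (fun _ _ hpq => ⟨hpq.1, fun i hi => congrArg π (hpq.2 i hi)⟩)

/-- The action of a permutation `π` of the colors on the modified illumination
complex `B(Δ, S)`, induced by `(x, f) ↦ (x, π ∘ f)`. -/
def permActB {d : ℕ} (a : Fin (d + 1) → EuclideanSpace ℝ (Fin d)) {S : Type*}
    (π : Equiv.Perm S) : BComplex a S → BComplex a S :=
  Quot.map (fun p => (p.1, π ∘ p.2))
    (fun _ _ hpq => ⟨hpq.1, fun i hi => congrArg π (hpq.2 i hi)⟩)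

/-- The simplex `conv {a j : j ∈ J}` consists of the convex combinations supported on `J`. -/
lemma convexHull_image_eq_image_stdSimplex {ι E : Type*} [Fintype ι] [AddCommGroup E]
    [Module ℝ E] (a : ι → E) (J : Set ι) :
    convexHull ℝ (a '' J) =
      Fintype.linearCombination ℝ a '' {w ∈ stdSimplex ℝ ι | ∀ k ∉ J, w k = 0} := by
  classical
  apply Set.Subset.antisymm
  · refine convexHull_min ?_ (Convex.linear_image ?_ _)
    · rintro _ ⟨j, hj, rfl⟩
      refine ⟨Pi.single j 1, ⟨single_mem_stdSimplex ℝ j, fun k hk => ?_⟩, by simp⟩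
      exact Pi.single_eq_of_ne (fun h => hk (by rwa [h])) 1
    · intro v hv w hw p q hp hq hpq
      refine ⟨convex_stdSimplex ℝ ι hv.1 hw.1 hp hq hpq, fun k hk => ?_⟩
      simp [hv.2 k hk, hw.2 k hk]
  · rintro _ ⟨w, ⟨hw, hJ⟩, rfl⟩
    rw [Fintype.linearCombination_apply, ← Finset.sum_filter_of_ne (p := (· ∈ J))]
    · refine (convex_convexHull ℝ _).sum_mem (fun k _ => hw.1 k) ?_ fun k hk =>
        subset_convexHull ℝ _ ⟨k, (Finset.mem_filter.1 hk).2, rfl⟩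
      rw [Finset.sum_filter_of_ne, hw.2]
      exact fun k _ hk => by_contra fun h => hk (hJ k h)
    · exact fun k _ hk => by_contra fun h => hk (by simp [hJ k h])

section Coordinates

variable {d : ℕ} {a : Fin (d + 1) → EuclideanSpace ℝ (Fin d)}

/-- The only linear relations among the vertices are the multiples of `∑ i, a i = 0`. -/
lemma coeff_eq_of_sum_smul_eq_zero
    (hnondeg : LinearIndependent ℝ (fun i : Fin d => a i.succ - a 0)) (hbary : ∑ i, a i = 0)
    {c : Fin (d + 1) → ℝ} (hc : ∑ k, c k • a k = 0) (i j : Fin (d + 1)) : c i = c j := by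
  set m : ℝ := (∑ k, c k) / (d + 1) with hm
  have hd : (d + 1 : ℝ) ≠ 0 := by positivity
  have hsum : ∑ k, (c k - m) = 0 := by
    simp [Finset.sum_sub_distrib, hm]
    field_simp
    ring
  have hrel : ∑ k, (c k - m) • (a k - a 0) = 0 := by
    simp only [smul_sub, Finset.sum_sub_distrib, ← Finset.sum_smul, hsum, zero_smul, sub_zero]
    simp only [sub_smul, Finset.sum_sub_distrib, hc, ← Finset.smul_sum, hbary, smul_zero,
      sub_zero]
  have hsucc : ∀ k : Fin d, c k.succ - m = 0 := by
    rw [Fin.sum_univ_succ, sub_self, smul_zero, zero_add] at hrel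
    exact Fintype.linearIndependent_iff.1 hnondeg (fun k => c k.succ - m) hrel
  have hall : ∀ k, c k = m := by
    refine Fin.cases ?_ fun k => sub_eq_zero.1 (hsucc k)
    rw [Fin.sum_univ_succ, Finset.sum_eq_zero fun k _ => hsucc k] at hsum
    linarith
  rw [hall i, hall j]

lemma sub_eq_sub_of_sum_smul_eq
    (hnondeg : LinearIndependent ℝ (fun i : Fin d => a i.succ - a 0)) (hbary : ∑ i, a i = 0)
    {c c' : Fin (d + 1) → ℝ} (hc : ∑ k, c k • a k = ∑ k, c' k • a k) (i j : Fin (d + 1)) :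
    c i - c j = c' i - c' j := by
  have h := coeff_eq_of_sum_smul_eq_zero hnondeg hbary (c := c - c')
    (by simp [sub_smul, Finset.sum_sub_distrib, hc]) i j
  simp only [Pi.sub_apply] at h
  linarith

/-- A continuous choice of coordinates with respect to the vertices. -/
lemma exists_continuous_coords
    (hnondeg : LinearIndependent ℝ (fun i : Fin d => a i.succ - a 0)) :
    ∃ e : EuclideanSpace ℝ (Fin d) →L[ℝ] (Fin (d + 1) → ℝ), ∀ x, ∑ k, e x k • a k = x := by
  have hsurj : LinearMap.range (Fintype.linearCombination ℝ a) = ⊤ := by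
    rw [Fintype.range_linearCombination, eq_top_iff,
      ← hnondeg.span_eq_top_of_card_eq_finrank' (by simp), Submodule.span_le]
    rintro _ ⟨k, rfl⟩
    exact Submodule.sub_mem _ (Submodule.subset_span ⟨_, rfl⟩) (Submodule.subset_span ⟨_, rfl⟩)
  obtain ⟨g, hg⟩ := (Fintype.linearCombination ℝ a).exists_rightInverse_of_surjective hsurj
  exact ⟨g.toContinuousLinearMap, fun x => LinearMap.congr_fun hg x⟩

lemma sum_add_const_smul (hbary : ∑ i, a i = 0) (c : Fin (d + 1) → ℝ) (m : ℝ) :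
    ∑ k, (c k + m) • a k = ∑ k, c k • a k := by
  simp [add_smul, Finset.sum_add_distrib, ← Finset.smul_sum, hbary]

lemma sum_smul_mem_zonotope_iff
    (hnondeg : LinearIndependent ℝ (fun i : Fin d => a i.succ - a 0)) (hbary : ∑ i, a i = 0)
    (c : Fin (d + 1) → ℝ) :
    ∑ k, c k • a k ∈ zonotope a ↔ ∀ i j, c i - c j ≤ 1 := by
  constructor
  · rintro ⟨t, ht, h⟩ i j
    rw [sub_eq_sub_of_sum_smul_eq hnondeg hbary h]
    linarith [(ht i).2, (ht j).1]
  · intro h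
    obtain ⟨m, hm⟩ := Finite.exists_min c
    exact ⟨fun k => c k + -c m, fun k => ⟨by linarith [hm k], by linarith [h k m]⟩,
      (sum_add_const_smul hbary c _).symm⟩

lemma sum_smul_mem_add_coneFace_iff
    (hnondeg : LinearIndependent ℝ (fun i : Fin d => a i.succ - a 0)) (hbary : ∑ i, a i = 0)
    (c y : Fin (d + 1) → ℝ) (i : Fin (d + 1)) :
    ∑ k, y k • a k ∈ ((∑ k, c k • a k) + ·) '' coneFace a i ↔
      ∀ j, c j - c i ≤ y j - y i := by
  constructor
  · rintro ⟨_, ⟨t, ht, hti, rfl⟩, h⟩ j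
    simp only [← Finset.sum_add_distrib, ← add_smul] at h
    rw [← sub_eq_sub_of_sum_smul_eq hnondeg hbary h j i]
    linarith [ht j]
  · intro h
    refine ⟨∑ k, (y k - c k + -(y i - c i)) • a k,
      ⟨fun k => y k - c k + -(y i - c i), fun k => by linarith [h k], by ring, rfl⟩, ?_⟩
    simp only [sum_add_const_smul hbary (fun k => y k - c k)]
    simp [sub_smul, Finset.sum_sub_distrib]

/-- The facet cone `cone (F i)` illuminates `x = ∑ k, c k • a k` iff no coordinate of `x` exceeds
the `i`-th one by at least `1`. -/
lemma interior_add_coneFace_inter_interior_zonotope_nonempty_iff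
    (hnondeg : LinearIndependent ℝ (fun i : Fin d => a i.succ - a 0)) (hbary : ∑ i, a i = 0)
    (c : Fin (d + 1) → ℝ) (i : Fin (d + 1)) :
    (interior (((∑ k, c k • a k) + ·) '' coneFace a i) ∩ interior (zonotope a)).Nonempty ↔
      ∀ j, c j - c i < 1 := by
  obtain ⟨e, he⟩ := exists_continuous_coords hnondeg
  constructor
  · rintro ⟨y, hyc, hyR⟩ j
    have hlt : e y j - e y i < 1 := by
      have hcont : Filter.Tendsto (fun ε : ℝ => (1 + ε) • y) (nhdsWithin 0 (Set.Ioi 0))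
          (nhds y) := by
        have : Continuous fun ε : ℝ => (1 + ε) • y := by fun_prop
        simpa using (this.tendsto 0).mono_left nhdsWithin_le_nhds
      obtain ⟨ε, hε, hε0⟩ := ((hcont.eventually_mem (mem_interior_iff_mem_nhds.1 hyR)).and
        self_mem_nhdsWithin).exists
      rw [← he ((1 + ε) • y), sum_smul_mem_zonotope_iff hnondeg hbary] at hε
      have := hε j i
      simp only [map_smul, Pi.smul_apply, smul_eq_mul] at this
      have hε0 : 0 < ε := hε0
      nlinarith
    have hy := interior_subset hyc
    rw [← he y, sum_smul_mem_add_coneFace_iff hnondeg hbary] at hy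
    linarith [hy j]
  · intro h
    let y : Fin (d + 1) → ℝ := fun j => if j = i then 0 else (1 + max (c j - c i) 0) / 2
    have hdiff : ∀ j k, e (∑ k, y k • a k) j - e (∑ k, y k • a k) k = y j - y k :=
      sub_eq_sub_of_sum_smul_eq hnondeg hbary (he _)
    have hmax : ∀ j, max (c j - c i) 0 < 1 := fun j => max_lt (h j) one_pos
    refine ⟨∑ k, y k • a k, mem_interior.2
      ⟨⋂ j, ⋂ (_ : j ≠ i), {z | c j - c i < e z j - e z i}, fun z hz => ?_, ?_, ?_⟩, mem_interior.2
      ⟨⋂ j, ⋂ k, {z | e z j - e z k < 1}, fun z hz => ?_, ?_, ?_⟩⟩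
    · rw [← he z, sum_smul_mem_add_coneFace_iff hnondeg hbary]
      intro j
      rcases eq_or_ne j i with rfl | hj
      · simp
      · simp only [Set.mem_iInter] at hz
        exact (hz j hj).le
    · exact isOpen_iInter_of_finite fun j => isOpen_iInter_of_finite fun _ =>
        isOpen_lt (by fun_prop) (by fun_prop)
    · simp only [Set.mem_iInter, Set.mem_ofPred_eq, hdiff]
      intro j hj
      simp only [y, hj, if_true, if_false]
      linarith [h j, le_max_left (c j - c i) 0]
    · rw [← he z, sum_smul_mem_zonotope_iff hnondeg hbary]
      simp only [Set.mem_iInter] at hz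
      exact fun j k => (hz j k).le
    · exact isOpen_iInter_of_finite fun j => isOpen_iInter_of_finite fun _ =>
        isOpen_lt (by fun_prop) (by fun_prop)
    · simp only [Set.mem_iInter, Set.mem_ofPred_eq, hdiff]
      intro j k
      have hy : ∀ j, 0 ≤ y j ∧ y j < 1 := by
        intro j
        simp only [y]
        split_ifs
        · norm_num
        · constructor <;> linarith [hmax j, le_max_right (c j - c i) 0]
      linarith [hy j, hy k]

lemma injOn_linearCombination_stdSimplex
    (hnondeg : LinearIndependent ℝ (fun i : Fin d => a i.succ - a 0)) (hbary : ∑ i, a i = 0) :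
    Set.InjOn (Fintype.linearCombination ℝ a) (stdSimplex ℝ (Fin (d + 1))) := by
  intro v hv w hw h
  have hdiff := sub_eq_sub_of_sum_smul_eq hnondeg hbary h
  funext i
  have hsum : ∑ j, (v j - w j) = ∑ _j : Fin (d + 1), (v i - w i) :=
    Finset.sum_congr rfl fun j _ => by linarith [hdiff j i]
  rw [Finset.sum_sub_distrib, hv.2, hw.2, Finset.sum_const, sub_self, nsmul_eq_mul] at hsum
  have := (mul_eq_zero.1 hsum.symm).resolve_left (by simp; positivity)
  linarith

lemma linearCombination_mem_facet_iff
    (hnondeg : LinearIndependent ℝ (fun i : Fin d => a i.succ - a 0)) (hbary : ∑ i, a i = 0)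
    {w : Fin (d + 1) → ℝ} (hw : w ∈ stdSimplex ℝ (Fin (d + 1))) (i : Fin (d + 1)) :
    Fintype.linearCombination ℝ a w ∈ facet a i ↔ w i = 0 := by
  rw [facet, convexHull_image_eq_image_stdSimplex]
  constructor
  · rintro ⟨v, ⟨hv, hvi⟩, h⟩
    rw [← injOn_linearCombination_stdSimplex hnondeg hbary hv hw h]
    exact hvi i (by simp)
  · intro h
    exact ⟨w, ⟨hw, fun k hk => by simp_all⟩, rfl⟩

end Coordinates

section StdSimplex

variable {ι : Type*} [Fintype ι]

lemma exists_apply_eq_norm_of_mem_stdSimplex {w : ι → ℝ} (hw : w ∈ stdSimplex ℝ ι) :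
    ∃ m, w m = ‖w‖ := by
  have : Nonempty ι := by
    by_contra h
    rw [not_nonempty_iff] at h
    simpa using hw.2
  obtain ⟨m, hm⟩ := Finite.exists_max w
  refine ⟨m, le_antisymm ((le_abs_self _).trans (norm_le_pi_norm w m)) ?_⟩
  refine (pi_norm_le_iff_of_nonneg (hw.1 m)).2 fun i => ?_
  rw [Real.norm_of_nonneg (hw.1 i)]
  exact hm i

lemma norm_pos_of_mem_stdSimplex {w : ι → ℝ} (hw : w ∈ stdSimplex ℝ ι) : 0 < ‖w‖ := by
  refine norm_pos_iff.2 ?_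
  rintro rfl
  simpa using hw.2

lemma div_norm_mem_Icc_of_mem_stdSimplex {w : ι → ℝ} (hw : w ∈ stdSimplex ℝ ι) (i : ι) :
    w i / ‖w‖ ∈ Set.Icc (0 : ℝ) 1 :=
  ⟨div_nonneg (hw.1 i) (norm_nonneg _),
    div_le_one_of_le₀ ((le_abs_self _).trans (norm_le_pi_norm w i)) (norm_nonneg _)⟩

end StdSimplex

section Homeomorphisms

variable {d : ℕ} {a : Fin (d + 1) → EuclideanSpace ℝ (Fin d)}

/-- Barycentric coordinates on the simplex. -/
lemma exists_homeomorph_stdSimplex_convexHull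
    (hnondeg : LinearIndependent ℝ (fun i : Fin d => a i.succ - a 0)) (hbary : ∑ i, a i = 0) :
    ∃ φ : stdSimplex ℝ (Fin (d + 1)) ≃ₜ convexHull ℝ (Set.range a),
      ∀ w, (φ w : EuclideanSpace ℝ (Fin d)) = Fintype.linearCombination ℝ a w.1 := by
  have hrange : convexHull ℝ (Set.range a) =
      Fintype.linearCombination ℝ a '' stdSimplex ℝ (Fin (d + 1)) := by
    rw [← Set.image_univ, convexHull_image_eq_image_stdSimplex]
    simp
  let f : stdSimplex ℝ (Fin (d + 1)) → convexHull ℝ (Set.range a) :=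
    fun w => ⟨Fintype.linearCombination ℝ a w.1, hrange ▸ Set.mem_image_of_mem _ w.2⟩
  have hf : Function.Bijective f := by
    constructor
    · intro v w h
      exact Subtype.ext
        (injOn_linearCombination_stdSimplex hnondeg hbary v.2 w.2 (congrArg Subtype.val h))
    · rintro ⟨x, hx⟩
      obtain ⟨w, hw, rfl⟩ := hrange ▸ hx
      exact ⟨⟨w, hw⟩, rfl⟩
  have hcont : Continuous f := by
    refine Continuous.subtype_mk ?_ _
    simp only [Fintype.linearCombination_apply]
    exact continuous_finsetSum _ fun k _ =>
      ((continuous_apply k).comp continuous_subtype_val).smul continuous_const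
  exact ⟨hcont.homeoOfEquivCompactToT2 (f := Equiv.ofBijective f hf), fun _ => rfl⟩

/-- Radial rescaling of barycentric coordinates, from the simplex to the zonotope. -/
lemma exists_homeomorph_stdSimplex_zonotope
    (hnondeg : LinearIndependent ℝ (fun i : Fin d => a i.succ - a 0)) (hbary : ∑ i, a i = 0) :
    ∃ ψ : stdSimplex ℝ (Fin (d + 1)) ≃ₜ zonotope a,
      ∀ w, (ψ w : EuclideanSpace ℝ (Fin d)) =
        ∑ k, (w.1 k / ‖w.1‖) • a k := by
  let f : stdSimplex ℝ (Fin (d + 1)) → zonotope a := fun w =>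
    ⟨∑ k, (w.1 k / ‖w.1‖) • a k,
      _, div_norm_mem_Icc_of_mem_stdSimplex w.2, rfl⟩
  have hf : Function.Bijective f := by
    constructor
    · rintro ⟨v, hv⟩ ⟨w, hw⟩ h
      have hdiff := sub_eq_sub_of_sum_smul_eq (c := fun k => v k / ‖v‖)
        (c' := fun k => w k / ‖w‖) hnondeg hbary (congrArg Subtype.val h)
      have hv0 := norm_pos_of_mem_stdSimplex hv
      have hw0 := norm_pos_of_mem_stdSimplex hw
      have hv1 := fun i => (div_norm_mem_Icc_of_mem_stdSimplex hv i).2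
      have hw1 := fun i => (div_norm_mem_Icc_of_mem_stdSimplex hw i).2
      obtain ⟨m, hm⟩ := exists_apply_eq_norm_of_mem_stdSimplex hv
      obtain ⟨n, hn⟩ := exists_apply_eq_norm_of_mem_stdSimplex hw
      have hm' : v m / ‖v‖ = 1 := by rw [hm, div_self hv0.ne']
      have hn' : w n / ‖w‖ = 1 := by rw [hn, div_self hw0.ne']
      have heq : ∀ i, v i / ‖v‖ = w i / ‖w‖ := fun i => by
        linarith [hdiff i m, hdiff m n, hw1 m, hv1 n]
      have hnorm : ‖v‖ = ‖w‖ := by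
        have := Finset.sum_congr (rfl : Finset.univ = Finset.univ) fun i _ => heq i
        rw [← Finset.sum_div, ← Finset.sum_div, hv.2, hw.2] at this
        simpa using this
      ext i
      have := heq i
      rw [hnorm] at this
      exact (div_left_inj' hw0.ne').1 this
    · rintro ⟨_, t, ht, rfl⟩
      obtain ⟨m, hm⟩ := Finite.exists_max t
      set s : Fin (d + 1) → ℝ := fun k => t k + (1 - t m) with hs
      have hs0 : ∀ k, 0 ≤ s k := fun k => by simp only [hs]; linarith [(ht k).1, (ht m).2]
      have hsm : s m = 1 := by simp [hs]
      have hs1 : ∀ k, s k ≤ 1 := fun k => by simp only [hs]; linarith [hm k]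
      have hnorm : ‖s‖ = 1 := by
        refine le_antisymm ((pi_norm_le_iff_of_nonneg zero_le_one).2 fun k => ?_) ?_
        · rw [Real.norm_of_nonneg (hs0 k)]
          exact hs1 k
        · exact hsm.symm.le.trans ((le_abs_self _).trans (norm_le_pi_norm s m))
      have hpos : 0 < ∑ k, s k :=
        Finset.sum_pos' (fun k _ => hs0 k) ⟨m, Finset.mem_univ _, by rw [hsm]; exact one_pos⟩
      refine ⟨⟨(∑ k, s k)⁻¹ • s, fun k => mul_nonneg (inv_nonneg.2 hpos.le) (hs0 k), ?_⟩,
        Subtype.ext ?_⟩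
      · simp only [Pi.smul_apply, smul_eq_mul, ← Finset.mul_sum]
        exact inv_mul_cancel₀ hpos.ne'
      · refine Eq.trans ?_ (sum_add_const_smul hbary t (1 - t m))
        change ∑ k, (((∑ k, s k)⁻¹ • s) k / ‖(∑ k, s k)⁻¹ • s‖) • a k = ∑ k, s k • a k
        refine Finset.sum_congr rfl fun k _ => ?_
        congr 1
        rw [norm_smul, hnorm, Real.norm_of_nonneg (inv_nonneg.2 hpos.le), Pi.smul_apply,
          smul_eq_mul, mul_one, mul_div_cancel_left₀ _ (inv_ne_zero hpos.ne')]
  have hcont : Continuous f := by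
    refine Continuous.subtype_mk (continuous_finsetSum _ fun k _ => ?_) _
    exact (((continuous_apply k).comp continuous_subtype_val).div
      continuous_subtype_val.norm fun w => (norm_pos_of_mem_stdSimplex w.2).ne').smul
      continuous_const
  exact ⟨hcont.homeoOfEquivCompactToT2 (f := Equiv.ofBijective f hf), fun _ => rfl⟩

/-- A homeomorphism from the zonotope to the simplex taking the points not illuminated by
`cone (F i)` to the facet `F i`. -/
lemma exists_homeomorph_zonotope_convexHull
    (hnondeg : LinearIndependent ℝ (fun i : Fin d => a i.succ - a 0)) (hbary : ∑ i, a i = 0) :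
    ∃ h : zonotope a ≃ₜ convexHull ℝ (Set.range a), ∀ (x : zonotope a) i,
      (interior (((x : EuclideanSpace ℝ (Fin d)) + ·) '' coneFace a i) ∩
          interior (zonotope a)).Nonempty ↔
        (h x : EuclideanSpace ℝ (Fin d)) ∉ facet a i := by
  obtain ⟨φ, hφ⟩ := exists_homeomorph_stdSimplex_convexHull hnondeg hbary
  obtain ⟨ψ, hψ⟩ := exists_homeomorph_stdSimplex_zonotope hnondeg hbary
  refine ⟨ψ.symm.trans φ, fun x i => ?_⟩
  obtain ⟨⟨w, hw⟩, rfl⟩ := ψ.surjective x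
  rw [Homeomorph.trans_apply, ψ.symm_apply_apply, hφ, hψ,
    interior_add_coneFace_inter_interior_zonotope_nonempty_iff hnondeg hbary,
    linearCombination_mem_facet_iff hnondeg hbary hw]
  have hpos := norm_pos_of_mem_stdSimplex hw
  constructor
  · intro h hi
    obtain ⟨m, hm⟩ := exists_apply_eq_norm_of_mem_stdSimplex hw
    have := h m
    simp [hm, hi, hpos.ne'] at this
  · intro hi j
    have := div_pos ((hw.1 i).lt_of_ne' hi) hpos
    linarith [(div_norm_mem_Icc_of_mem_stdSimplex hw j).2]

end Homeomorphisms

/-- **Comparison of illumination complexes.** For a non-degenerate simplex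
`Δ ⊂ ℝ^d` with barycenter at the origin and a finite non-empty color set `S`,
the complexes `A(R_Δ, F_Δ, S)` and `B(Δ, S)` are homeomorphic, equivariantly with
respect to every permutation of the colors. -/
theorem AComplex_homeomorphic_BComplex_equivariant (d : ℕ)
    (a : Fin (d + 1) → EuclideanSpace ℝ (Fin d))
    (hnondeg : LinearIndependent ℝ (fun i : Fin d => a i.succ - a 0))
    (hbary : ∑ i, a i = 0)
    (S : Type) [Fintype S] [Nonempty S] [TopologicalSpace S] [DiscreteTopology S] :
    ∃ h : AComplex a S ≃ₜ BComplex a S,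
      ∀ (π : Equiv.Perm S) (z : AComplex a S),
        h (permActA a π z) = permActB a π (h z) := by
  obtain ⟨h, hh⟩ := exists_homeomorph_zonotope_convexHull hnondeg hbary
  refine ⟨Homeomorph.Quot.congr (h.prodCongr (Homeomorph.refl _)) fun p q => ?_, ?_⟩
  · simp only [ARel, BRel, hh, Homeomorph.coe_prodCongr, Prod.map_fst, Prod.map_snd,
      h.injective.eq_iff, Homeomorph.refl_apply, id_eq]
  · rintro π ⟨x, f⟩
    rfl
end
end
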